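/- Let n ≥ 1, 1 ≤ p < ∞, 0 < α < 2, and let (φ,ψ) be a parabolic Littlewood–Paley family on ℝ^{n+1}. There exist constants c, C > 0 (depending only on n, p, α, φ, ψ) such that for every Schwartz function f on ℝ^{n+1}: c·N_{α,p}(f) ≤ ‖f‖_{Lᵖ(ℝ^{n+1})} + ( ∫_{ℝⁿ}∫_ℝ∫_ℝ |f(X,t) − f(X,s)|^p/|t−s|^{1+pα/2} dt ds dX )^{1/p} + ( ∫_ℝ∫_{ℝⁿ}∫_{ℝⁿ} |f(X+Y,t) − 2f(X,t) + f(X−Y,t)|^p/|Y|^{n+pα} dY dX dt )^{1/p} ≤ C·N_{α,p}(f). -/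

import Mathlib

noncomputable section

open MeasureTheory Real Complex
open scoped ENNReal NNReal Real BigOperators

/-- Euclidean space `ℝⁿ`. -/
abbrev Rn (n : ℕ) : Type := EuclideanSpace ℝ (Fin n)

/-- The space `ℝ^{n+1} = ℝⁿ × ℝ`, points written `(X, t)`. -/
abbrev Rn1 (n : ℕ) : Type := EuclideanSpace ℝ (Fin n) × ℝ

/-- Fourier transform on `ℝ^{n+1}`:
`𝓕f(ξ,τ) = ∫ e^{−2πi(X·ξ + tτ)} f(X,t) dX dt`. -/
def FT1 {n : ℕ} (f : Rn1 n → ℂ) (q : Rn1 n) : ℂ :=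
  ∫ p : Rn1 n,
    Complex.exp (-(2 * (π : ℂ) * Complex.I) *
      (((∑ k, p.1 k * q.1 k) + p.2 * q.2 : ℝ) : ℂ)) * f p

/-- Inverse Fourier transform on `ℝ^{n+1}`. -/
def IFT1 {n : ℕ} (f : Rn1 n → ℂ) (x : Rn1 n) : ℂ :=
  ∫ q : Rn1 n,
    Complex.exp ((2 * (π : ℂ) * Complex.I) *
      (((∑ k, q.1 k * x.1 k) + q.2 * x.2 : ℝ) : ℂ)) * f q

/-- The Fourier multiplier operator `f ↦ 𝓕⁻¹(m · 𝓕 f)` on `ℝ^{n+1}`. -/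
def MOp {n : ℕ} (m : Rn1 n → ℂ) (f : Rn1 n → ℂ) : Rn1 n → ℂ :=
  IFT1 (fun q => m q * FT1 f q)

/-- The symbol `m_α(ξ,τ) = (1 + 4π²|ξ|² + iτ)^{α/2}` (principal branch). -/
def mSym {n : ℕ} (α : ℝ) (q : Rn1 n) : ℂ :=
  (1 + 4 * (π : ℂ) ^ 2 * (‖q.1‖ : ℂ) ^ 2 + Complex.I * (q.2 : ℂ)) ^ ((α : ℂ) / 2)

/-- Partial derivative `∂_{X_k}`. -/
def dX {n : ℕ} (k : Fin n) (f : Rn1 n → ℂ) : Rn1 n → ℂ :=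
  fun x => fderiv ℝ f x (EuclideanSpace.single k 1, 0)

/-- Partial derivative `∂_t`. -/
def dT {n : ℕ} (f : Rn1 n → ℂ) : Rn1 n → ℂ :=
  fun x => fderiv ℝ f x (0, 1)

/-- Iterated spatial derivative `D_X^β` for a multi-index `β`. -/
def dXmulti {n : ℕ} (β : Fin n → ℕ) (f : Rn1 n → ℂ) : Rn1 n → ℂ :=
  (List.finRange n).foldr (fun k g => (dX k)^[β k] g) f

/-- The half time-derivative `D_t^{1/2} f = 𝓕⁻¹(|τ|^{1/2}·𝓕f)`. -/
def halfDt {n : ℕ} (f : Rn1 n → ℂ) : Rn1 n → ℂ :=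
  MOp (fun q => ((|q.2| ^ ((1 : ℝ) / 2) : ℝ) : ℂ)) f

/-- The `Lᵖ(ℝ^{n+1})` norm (as a value in `ℝ≥0∞`), `p` a real exponent. -/
def pNorm {n : ℕ} (p : ℝ) (f : Rn1 n → ℂ) : ℝ≥0∞ :=
  eLpNorm f (ENNReal.ofReal p) volume

/-- Multi-indices `β ∈ ℕⁿ` with `|β| = N`. -/
def multiIdx (n N : ℕ) : Finset (Fin n → ℕ) :=
  (Fintype.piFinset fun _ : Fin n => Finset.range (N + 1)).filter fun β => (∑ k, β k) = N

/-- Convolution on `ℝ^{n+1}`. -/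
def conv1 {n : ℕ} (g f : Rn1 n → ℂ) : Rn1 n → ℂ :=
  fun x => ∫ y : Rn1 n, g (x - y) * f y

/-- A parabolic Littlewood–Paley family on `ℝ^{n+1}`. -/
structure ParabolicLP (n : ℕ) where
  φ : SchwartzMap (Rn1 n) ℂ
  ψ : SchwartzMap (Rn1 n) ℂ
  ft_pos : ∀ q : Rn1 n,
    1 / 2 < ‖q.1‖ + |q.2| ^ ((1 : ℝ) / 2) → ‖q.1‖ + |q.2| ^ ((1 : ℝ) / 2) < 2 →
      0 < (FT1 (⇑φ) q).re ∧ (FT1 (⇑φ) q).im = 0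
  ft_supp : ∀ q : Rn1 n,
    ¬(1 / 2 < ‖q.1‖ + |q.2| ^ ((1 : ℝ) / 2) ∧ ‖q.1‖ + |q.2| ^ ((1 : ℝ) / 2) < 2) →
      FT1 (⇑φ) q = 0
  ft_sum : ∀ q : Rn1 n, q ≠ 0 →
    ∑' i : ℤ, FT1 (⇑φ) (((2 : ℝ) ^ (-i)) • q.1, ((2 : ℝ) ^ (-(2 * i))) * q.2) = 1
  ft_psi : ∀ q : Rn1 n,
    FT1 (⇑ψ) q =
      1 - ∑' i : ℕ,
        FT1 (⇑φ) (((2 : ℝ) ^ (-((i : ℤ) + 1))) • q.1, ((2 : ℝ) ^ (-(2 * ((i : ℤ) + 1)))) * q.2)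

/-- The dilate `φ_i`, whose Fourier transform is `𝓕φ(2^{−i}ξ, 2^{−2i}τ)`. -/
def lpPhi {n : ℕ} (P : ParabolicLP n) (i : ℕ) : Rn1 n → ℂ :=
  fun x => (((2 : ℝ) ^ (i * (n + 2)) : ℝ) : ℂ) *
    P.φ (((2 : ℝ) ^ i) • x.1, ((2 : ℝ) ^ (2 * i)) * x.2)

/-- Parabolic Besov norm `N_{s,p}(f)` on `ℝ^{n+1}`, `1 ≤ p < ∞`. -/
def pBesov {n : ℕ} (P : ParabolicLP n) (s p : ℝ) (f : Rn1 n → ℂ) : ℝ≥0∞ :=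
  eLpNorm (conv1 (⇑P.ψ) f) (ENNReal.ofReal p) volume +
  (∑' i : ℕ,
    (ENNReal.ofReal ((2 : ℝ) ^ (s * ((i : ℝ) + 1))) *
      eLpNorm (conv1 (lpPhi P (i + 1)) f) (ENNReal.ofReal p) volume) ^ p) ^ (1 / p)

/-- Parabolic Besov norm `N_{s,∞}(f)` on `ℝ^{n+1}`. -/
def pBesovInf {n : ℕ} (P : ParabolicLP n) (s : ℝ) (f : Rn1 n → ℂ) : ℝ≥0∞ :=
  max (eLpNorm (conv1 (⇑P.ψ) f) ⊤ volume)
    (⨆ i : ℕ, ENNReal.ofReal ((2 : ℝ) ^ (s * ((i : ℝ) + 1))) *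
      eLpNorm (conv1 (lpPhi P (i + 1)) f) ⊤ volume)

/-- The time interval `(0, T)` for `0 < T ≤ ∞`. -/
def tSet (T : ℝ≥0∞) : Set ℝ := {t : ℝ | 0 < t ∧ ENNReal.ofReal t < T}

/-- Lebesgue measure restricted to the strip `ℝⁿ × (0,T)`. -/
def stripMeasure (n : ℕ) (T : ℝ≥0∞) : Measure (Rn1 n) :=
  volume.restrict {x : Rn1 n | x.2 ∈ tSet T}

/-- The parabolic Sobolev norm `‖g‖_{W^{2i,i}_p(ℝⁿ_T)}`. -/
def wNorm {n : ℕ} (i : ℕ) (p : ℝ) (T : ℝ≥0∞) (g : Rn1 n → ℂ) : ℝ≥0∞ :=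
  ∑ l ∈ Finset.range (i + 1),
    ∑ β ∈ (Fintype.piFinset fun _ : Fin n => Finset.range (2 * i + 1)).filter
        (fun β => (∑ k, β k) + 2 * l ≤ 2 * i),
      eLpNorm (dXmulti β (dT^[l] g)) (ENNReal.ofReal p) (stripMeasure n T)

/-- Time-regularity seminorm `[g]_{t,β,p,T}`. -/
def semT {n : ℕ} (b p : ℝ) (T : ℝ≥0∞) (g : Rn1 n → ℂ) : ℝ≥0∞ :=
  (∫⁻ X : Rn n, ∫⁻ t in tSet T, ∫⁻ s in tSet T,
      ENNReal.ofReal (‖g (X, t) - g (X, s)‖ ^ p / |t - s| ^ (1 + p * b / 2))) ^ (1 / p)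

/-- Space-regularity seminorm `[g]_{x,β,p,T}`. -/
def semX {n : ℕ} (b p : ℝ) (T : ℝ≥0∞) (g : Rn1 n → ℂ) : ℝ≥0∞ :=
  (∫⁻ t in tSet T, ∫⁻ X : Rn n, ∫⁻ Y : Rn n,
      ENNReal.ofReal (‖g (X + Y, t) - 2 * g (X, t) + g (X - Y, t)‖ ^ p /
        ‖Y‖ ^ ((n : ℝ) + p * b))) ^ (1 / p)

/-- The parabolic Besov norm `‖g‖_{B^{α,α/2}_p(ℝⁿ_T)}`, formed with index `i` where
`2i < α < 2i+2`. -/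
def pbNorm {n : ℕ} (i : ℕ) (α p : ℝ) (T : ℝ≥0∞) (g : Rn1 n → ℂ) : ℝ≥0∞ :=
  wNorm i p T g +
  ∑ l ∈ Finset.range (i + 1),
    ∑ β ∈ (Fintype.piFinset fun _ : Fin n => Finset.range (2 * i + 1)).filter
        (fun β => (∑ k, β k) + 2 * l = 2 * i),
      (semT (α - 2 * i) p T (dXmulti β (dT^[l] g)) +
        semX (α - 2 * i) p T (dXmulti β (dT^[l] g)))

/-- Fourier transform on `ℝⁿ`. -/
def FTn {n : ℕ} (f : Rn n → ℂ) (ξ : Rn n) : ℂ :=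
  ∫ x : Rn n, Complex.exp (-(2 * (π : ℂ) * Complex.I) * (((∑ k, x k * ξ k : ℝ)) : ℂ)) * f x

/-- Inverse Fourier transform on `ℝⁿ`. -/
def IFTn {n : ℕ} (f : Rn n → ℂ) (x : Rn n) : ℂ :=
  ∫ ξ : Rn n, Complex.exp ((2 * (π : ℂ) * Complex.I) * (((∑ k, ξ k * x k : ℝ)) : ℂ)) * f ξ

/-- Convolution on `ℝⁿ`. -/
def convn {n : ℕ} (g f : Rn n → ℂ) : Rn n → ℂ := fun x => ∫ y : Rn n, g (x - y) * f y

/-- A Littlewood–Paley family on `ℝⁿ`. -/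
structure LPFamily (n : ℕ) where
  φ : SchwartzMap (Rn n) ℂ
  ψ : SchwartzMap (Rn n) ℂ
  ft_pos : ∀ ξ : Rn n, 1 / 2 < ‖ξ‖ → ‖ξ‖ < 2 →
    0 < (FTn (⇑φ) ξ).re ∧ (FTn (⇑φ) ξ).im = 0
  ft_supp : ∀ ξ : Rn n, ¬(1 / 2 < ‖ξ‖ ∧ ‖ξ‖ < 2) → FTn (⇑φ) ξ = 0
  ft_sum : ∀ ξ : Rn n, ξ ≠ 0 → ∑' i : ℤ, FTn (⇑φ) (((2 : ℝ) ^ (-i)) • ξ) = 1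
  ft_psi : ∀ ξ : Rn n,
    FTn (⇑ψ) ξ = 1 - ∑' i : ℕ, FTn (⇑φ) (((2 : ℝ) ^ (-((i : ℤ) + 1))) • ξ)

/-- The dilate `φ′_i(x) = 2^{in} φ′(2^i x)`. -/
def lpPhin {n : ℕ} (P : LPFamily n) (i : ℕ) : Rn n → ℂ :=
  fun x => (((2 : ℝ) ^ (i * n) : ℝ) : ℂ) * P.φ (((2 : ℝ) ^ i) • x)

/-- Besov norm `B_{s,p}(f)` on `ℝⁿ`, `1 ≤ p < ∞`. -/
def besovN {n : ℕ} (P : LPFamily n) (s p : ℝ) (f : Rn n → ℂ) : ℝ≥0∞ :=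
  eLpNorm (convn (⇑P.ψ) f) (ENNReal.ofReal p) volume +
  (∑' i : ℕ,
    (ENNReal.ofReal ((2 : ℝ) ^ (s * ((i : ℝ) + 1))) *
      eLpNorm (convn (lpPhin P (i + 1)) f) (ENNReal.ofReal p) volume) ^ p) ^ (1 / p)

/-- The heat kernel `Γ(X,t)` on `ℝⁿ` (zero for `t ≤ 0`). -/
def heatKer (n : ℕ) (X : Rn n) (t : ℝ) : ℝ :=
  if 0 < t then (4 * π * t) ^ (-(n : ℝ) / 2) * Real.exp (-‖X‖ ^ 2 / (4 * t)) else 0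

/-- The heat extension `u(X,t) = ∫ Γ(X−Y,t) f(Y) dY`. -/
def heatExt {n : ℕ} (f : Rn n → ℂ) : Rn1 n → ℂ :=
  fun x => ∫ Y : Rn n, (heatKer n (x.1 - Y) x.2 : ℂ) * f Y

theorem rpow_lintegral_mul_le {X : Type*} [MeasurableSpace X] (ν : Measure X) {p : ℝ} (hp : 1 ≤ p)
    {k W : X → ℝ≥0∞} (hk : AEMeasurable k ν) (hW : AEMeasurable W ν) :
    (∫⁻ x, k x * W x ∂ν) ^ p ≤ (∫⁻ x, k x ∂ν) ^ (p - 1) * ∫⁻ x, k x * W x ^ p ∂ν := by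
  rcases hp.eq_or_lt with rfl | hp
  · simp
  have hpq : p.HolderConjugate (p / (p - 1)) := Real.HolderConjugate.conjExponent hp
  have h := ENNReal.lintegral_mul_le_Lp_mul_Lq ν hpq
    ((hk.pow_const (1 / p)).mul hW) (hk.pow_const (1 / (p / (p - 1))))
  have e1 : ∀ x, k x * W x = (k x ^ (1 / p) * W x) * k x ^ (1 / (p / (p - 1))) := by
    intro x
    rw [mul_right_comm, ← ENNReal.rpow_add_of_nonneg _ _ hpq.one_div_nonneg
      hpq.symm.one_div_nonneg]
    have := hpq.inv_add_inv_eq_one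
    rw [← one_div, ← one_div] at this
    rw [this, ENNReal.rpow_one]
  simp_rw [e1]
  refine (ENNReal.rpow_le_rpow h (by positivity)).trans ?_
  rw [ENNReal.mul_rpow_of_nonneg _ _ (by positivity), ← ENNReal.rpow_mul, ← ENNReal.rpow_mul,
    mul_comm]
  have hp0 : p ≠ 0 := by positivity
  have hp1 : p - 1 ≠ 0 := by linarith
  have e2 : 1 / (p / (p - 1)) * p = p - 1 := by field_simp
  have e3 : 1 / p * p = 1 := by field_simp
  rw [e2, e3, ENNReal.rpow_one]
  gcongr with x x
  · rw [← ENNReal.rpow_mul]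
    field_simp
    simp
  · simp only [Pi.mul_apply]
    rw [ENNReal.mul_rpow_of_nonneg _ _ (by positivity), ← ENNReal.rpow_mul, e3, ENNReal.rpow_one]

theorem rpow_tsum_mul_le {p : ℝ} (hp : 1 ≤ p) (k W : ℕ → ℝ≥0∞) :
    (∑' i, k i * W i) ^ p ≤ (∑' i, k i) ^ (p - 1) * ∑' i, k i * W i ^ p := by
  have := rpow_lintegral_mul_le (Measure.count (α := ℕ)) hp (k := k) (W := W)
    (by fun_prop) (by fun_prop)
  simpa [lintegral_count] using this

theorem rpow_tsum_le {p : ℝ} (hp : 1 ≤ p) (w V : ℕ → ℝ≥0∞) (hw : ∀ i, w i ≠ 0)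
    (hw' : ∀ i, w i ≠ ⊤) :
    (∑' i, V i) ^ p ≤ (∑' i, w i) ^ (p - 1) * ∑' i, w i ^ (1 - p) * V i ^ p := by
  have := rpow_tsum_mul_le hp w (fun i => (w i)⁻¹ * V i)
  have e : ∀ i, w i * ((w i)⁻¹ * V i) = V i := fun i => by
    rw [← mul_assoc, ENNReal.mul_inv_cancel (hw i) (hw' i), one_mul]
  simp_rw [e] at this
  refine this.trans (le_of_eq ?_)
  congr 2
  ext i
  rw [ENNReal.mul_rpow_of_nonneg _ _ (by positivity), ← mul_assoc, ENNReal.inv_rpow,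
    ENNReal.rpow_sub _ _ (hw i) (hw' i), ENNReal.rpow_one, div_eq_mul_inv]

section scaling
variable {E : Type*} [NormedAddCommGroup E] [NormedSpace ℝ E] [FiniteDimensional ℝ E]
  [MeasurableSpace E] [BorelSpace E] (μ : Measure E) [μ.IsAddHaarMeasure]

theorem lintegral_comp_smul_addHaar (f : E → ℝ≥0∞) {c : ℝ} (hc : 0 < c) :
    ∫⁻ x, f (c • x) ∂μ = ENNReal.ofReal ((c ^ Module.finrank ℝ E)⁻¹) * ∫⁻ x, f x ∂μ := by
  have h1 := (Homeomorph.smulOfNeZero c hc.ne' (α := E)).measurableEmbedding.lintegral_map f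
    (μ := μ)
  have h2 := Measure.map_addHaar_smul μ hc.ne'
  simp only [Homeomorph.smulOfNeZero_apply] at h1
  rw [← h1]
  change ∫⁻ a, f a ∂(Measure.map (fun x => c • x) μ) = _
  rw [h2, lintegral_smul_measure, abs_of_pos (by positivity), smul_eq_mul]

theorem lintegral_eq_mul_comp_smul (f : E → ℝ≥0∞) {c : ℝ} (hc : 0 < c) :
    ∫⁻ x, f x ∂μ = ENNReal.ofReal (c ^ Module.finrank ℝ E) * ∫⁻ x, f (c • x) ∂μ := by
  rw [lintegral_comp_smul_addHaar μ f hc, ← mul_assoc, ← ENNReal.ofReal_mul (by positivity),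
    mul_inv_cancel₀ (by positivity), ENNReal.ofReal_one, one_mul]

end scaling

theorem min_rpow_le_zpow {l a b : ℝ} (hl : 1 < l) (ha : 0 < a) (hb : 0 < b) {x : ℝ} {j : ℤ}
    (h1 : l ^ j ≤ x) (h2 : x < l ^ (j + 1)) :
    min (x ^ a) (x ^ (-b)) ≤ l ^ a * (l ^ (-min a b)) ^ j.natAbs := by
  have hl0 : 0 < l := by linarith
  have hx : 0 < x := lt_of_lt_of_le (by positivity) h1
  have e : (l ^ (-min a b)) ^ j.natAbs = l ^ (-min a b * (j.natAbs : ℝ)) := by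
    rw [Real.rpow_mul hl0.le, Real.rpow_natCast]
  rw [e]
  rcases le_or_gt 0 j with hj | hj
  · refine (min_le_right _ _).trans ?_
    have hja : ((j.natAbs : ℕ) : ℝ) = (j : ℝ) := by
      rw [Nat.cast_natAbs, abs_of_nonneg hj]
    have hj' : (0 : ℝ) ≤ (j : ℝ) := by exact_mod_cast hj
    calc x ^ (-b) ≤ (l ^ j) ^ (-b) :=
          Real.rpow_le_rpow_of_nonpos (by positivity) h1 (by linarith)
      _ = l ^ ((j : ℝ) * (-b)) := by rw [Real.rpow_mul hl0.le, Real.rpow_intCast]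
      _ ≤ l ^ (-min a b * (j.natAbs : ℝ)) := by
          apply Real.rpow_le_rpow_of_exponent_le hl.le
          rw [hja]
          nlinarith [min_le_right a b]
      _ ≤ l ^ a * l ^ (-min a b * (j.natAbs : ℝ)) :=
          le_mul_of_one_le_left (by positivity) (Real.one_le_rpow hl.le ha.le)
  · refine (min_le_left _ _).trans ?_
    have hja : ((j.natAbs : ℕ) : ℝ) = -(j : ℝ) := by
      rw [Nat.cast_natAbs, abs_of_neg hj]; simp
    have hj' : (j : ℝ) ≤ 0 := by exact_mod_cast hj.le
    calc x ^ a ≤ (l ^ (j + 1)) ^ a := Real.rpow_le_rpow hx.le h2.le ha.le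
      _ = l ^ (((j : ℝ) + 1) * a) := by
          rw [Real.rpow_mul hl0.le, ← Int.cast_one (R := ℝ), ← Int.cast_add, Real.rpow_intCast]
      _ ≤ l ^ (a + -min a b * (j.natAbs : ℝ)) := by
          apply Real.rpow_le_rpow_of_exponent_le hl.le
          rw [hja]
          nlinarith [min_le_left a b]
      _ = _ := Real.rpow_add hl0 _ _

theorem exists_tsum_min_rpow_le {l a b : ℝ} (hl : 1 < l) (ha : 0 < a) (hb : 0 < b) :
    ∃ A : ℝ≥0∞, A ≠ ⊤ ∧ ∀ r : ℝ, 0 < r →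
      ∑' i : ℕ, ENNReal.ofReal (min ((l ^ i * r) ^ a) ((l ^ i * r) ^ (-b))) ≤ A := by
  have hl0 : 0 < l := by linarith
  set q : ℝ := l ^ (-min a b) with hq
  have hq0 : 0 ≤ q := by positivity
  have hq1 : q < 1 := Real.rpow_lt_one_of_one_lt_of_neg hl (by simp [ha, hb])
  have hs : Summable (fun j : ℤ => l ^ a * q ^ j.natAbs) := by
    apply Summable.mul_left
    apply Summable.of_nat_of_neg <;> simpa using summable_geometric_of_lt_one hq0 hq1
  refine ⟨∑' j : ℤ, ENNReal.ofReal (l ^ a * q ^ j.natAbs), hs.tsum_ofReal_ne_top, ?_⟩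
  intro r hr
  obtain ⟨j, hj1, hj2⟩ := exists_mem_Ico_zpow hr hl
  calc _ ≤ ∑' i : ℕ, ENNReal.ofReal (l ^ a * q ^ ((i : ℤ) + j).natAbs) := by
        refine ENNReal.tsum_le_tsum fun i => ENNReal.ofReal_le_ofReal ?_
        apply min_rpow_le_zpow hl ha hb
        · rw [zpow_add₀ hl0.ne', zpow_natCast]; gcongr
        · rw [add_assoc, zpow_add₀ hl0.ne', zpow_natCast]; gcongr
    _ ≤ ∑' i : ℤ, ENNReal.ofReal (l ^ a * q ^ i.natAbs) := by
        refine ENNReal.tsum_comp_le_tsum_of_injective (f := fun i : ℕ => (i : ℤ) + j) ?_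
          (fun i : ℤ => ENNReal.ofReal (l ^ a * q ^ i.natAbs))
        intro x y h
        simpa using h

theorem lintegral_min_rpow_ne_top {E : Type*} [NormedAddCommGroup E] [NormedSpace ℝ E]
    [FiniteDimensional ℝ E] [MeasurableSpace E] [BorelSpace E] [Nontrivial E] (μ : Measure E)
    [μ.IsAddHaarMeasure] {a b : ℝ} (ha : 0 < a) (hb : 0 < b) :
    ∫⁻ x, ENNReal.ofReal (min (‖x‖ ^ a) (‖x‖ ^ (-b)) * ‖x‖ ^ (-(Module.finrank ℝ E : ℝ))) ∂μ
      ≠ ⊤ := by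
  have hd : 1 ≤ Module.finrank ℝ E := Module.finrank_pos
  have key : IntegrableOn (fun y : ℝ => min (y ^ (a - 1)) (y ^ (-b - 1))) (Set.Ioi 0) := by
    have hm : Measurable (fun y : ℝ => min (y ^ (a - 1)) (y ^ (-b - 1))) := by fun_prop
    rw [← Set.Ioc_union_Ioi_eq_Ioi (zero_le_one' ℝ)]
    refine IntegrableOn.union ?_ ?_
    · have h : IntegrableOn (fun y : ℝ => y ^ (a - 1)) (Set.Ioc 0 1) := by
        rw [← intervalIntegrable_iff_integrableOn_Ioc_of_le zero_le_one]
        exact intervalIntegral.intervalIntegrable_rpow' (by linarith)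
      refine Integrable.mono' h hm.aestronglyMeasurable ?_
      filter_upwards [ae_restrict_mem measurableSet_Ioc] with y hy
      have := hy.1
      rw [Real.norm_of_nonneg (by positivity)]
      exact min_le_left _ _
    · have h : IntegrableOn (fun y : ℝ => y ^ (-b - 1)) (Set.Ioi 1) :=
        integrableOn_Ioi_rpow_of_lt (by linarith) one_pos
      refine Integrable.mono' h hm.aestronglyMeasurable ?_
      filter_upwards [ae_restrict_mem measurableSet_Ioi] with y hy
      have : (0 : ℝ) < y := lt_trans one_pos hy
      rw [Real.norm_of_nonneg (by positivity)]
      exact min_le_right _ _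
  have h2 : Integrable (fun x : E =>
      (fun y : ℝ => min (y ^ a) (y ^ (-b)) * y ^ (-(Module.finrank ℝ E : ℝ))) ‖x‖) μ := by
    rw [integrable_fun_norm_addHaar μ
      (f := fun y : ℝ => min (y ^ a) (y ^ (-b)) * y ^ (-(Module.finrank ℝ E : ℝ)))]
    refine key.congr_fun ?_ measurableSet_Ioi
    intro y hy
    have hy : 0 < y := hy
    simp only [smul_eq_mul]
    rw [mul_left_comm, ← Real.rpow_natCast y, ← Real.rpow_add hy, Nat.cast_sub hd]
    rw [show ((Module.finrank ℝ E : ℕ) : ℝ) - ((1 : ℕ) : ℝ) + -(Module.finrank ℝ E : ℝ) = -1 by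
      push_cast; ring]
    rw [min_mul_of_nonneg _ _ (by positivity), ← Real.rpow_add hy, ← Real.rpow_add hy]
    rfl
  have := h2.lintegral_lt_top
  exact this.ne

section abstract
variable {E : Type*} [NormedAddCommGroup E] [NormedSpace ℝ E] [FiniteDimensional ℝ E]
  [MeasurableSpace E] [BorelSpace E] [Nontrivial E] (μ : Measure E) [μ.IsAddHaarMeasure]

theorem exists_lintegral_weight_le_tsum {X : Type*} [MeasurableSpace X] (ν : Measure X)
    {l β k p : ℝ} (hl : 1 < l) (hβ : 0 < β) (hk : β < k) (hp : 1 ≤ p) :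
    ∃ A : ℝ≥0∞, A ≠ ⊤ ∧ ∀ (G : E → X → ℝ≥0∞) (V : ℕ → E → X → ℝ≥0∞) (B : ℕ → ℝ≥0∞) (C : ℝ≥0∞),
      (∀ i h, Measurable (V i h)) → (∀ h x, G h x ≤ ∑' i, V i h x) →
      (∀ i h, ∫⁻ x, V i h x ^ p ∂ν ≤ C * ENNReal.ofReal (min 1 ((l ^ i * ‖h‖) ^ k)) ^ p * B i) →
      ∫⁻ h, ENNReal.ofReal (‖h‖ ^ (-((Module.finrank ℝ E : ℝ) + p * β))) *
        ∫⁻ x, G h x ^ p ∂ν ∂μ ≤ A * C * ∑' i, ENNReal.ofReal ((l ^ i) ^ (β * p)) * B i := by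
  obtain ⟨S, hS, hSle⟩ := exists_tsum_min_rpow_le hl (sub_pos.2 hk) hβ
  have hJ := lintegral_min_rpow_ne_top μ (sub_pos.2 hk) hβ
  set d := Module.finrank ℝ E with hd
  set J := ∫⁻ x, ENNReal.ofReal (min (‖x‖ ^ (k - β)) (‖x‖ ^ (-β)) * ‖x‖ ^ (-(d : ℝ))) ∂μ with hJdef
  have hl0 : 0 < l := by linarith
  refine ⟨S ^ (p - 1) * J, ENNReal.mul_ne_top (ENNReal.rpow_ne_top_of_nonneg (by linarith) hS) hJ,
    ?_⟩
  intro G V B C hV hG hVB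
  set W : ℝ → ℝ := fun u => min (u ^ (k - β)) (u ^ (-β)) with hW
  have hscale : ∀ i : ℕ, ∫⁻ h, ENNReal.ofReal (W (l ^ i * ‖h‖) * ‖h‖ ^ (-(d : ℝ))) ∂μ = J := by
    intro i
    symm
    rw [hJdef, lintegral_eq_mul_comp_smul μ _ (c := l ^ i) (by positivity),
      ← lintegral_const_mul' _ _ ENNReal.ofReal_ne_top]
    refine lintegral_congr fun h => ?_
    rw [← ENNReal.ofReal_mul (by positivity), norm_smul, Real.norm_of_nonneg (by positivity)]
    congr 1
    rw [Real.mul_rpow (by positivity) (by positivity) (z := -(d : ℝ)), mul_left_comm,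
      ← mul_assoc (_ ^ d), Real.rpow_neg (x := l ^ i) (by positivity) (d : ℝ), Real.rpow_natCast,
      mul_inv_cancel₀ (by positivity), one_mul]
  have hpt : ∀ h : E, h ≠ 0 →
      ENNReal.ofReal (‖h‖ ^ (-((d : ℝ) + p * β))) * ∫⁻ x, G h x ^ p ∂ν ≤
      S ^ (p - 1) * C * ∑' i, ENNReal.ofReal ((l ^ i) ^ (β * p)) * B i *
        ENNReal.ofReal (W (l ^ i * ‖h‖) * ‖h‖ ^ (-(d : ℝ))) := by
    intro h hh
    have hr : 0 < ‖h‖ := norm_pos_iff.2 hh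
    have hu : ∀ i : ℕ, 0 < l ^ i * ‖h‖ := fun i => by positivity
    have hWpos : ∀ i : ℕ, 0 < W (l ^ i * ‖h‖) := fun i =>
      lt_min (Real.rpow_pos_of_pos (hu i) _) (Real.rpow_pos_of_pos (hu i) _)
    have h1 : ∫⁻ x, G h x ^ p ∂ν ≤ S ^ (p - 1) *
        ∑' i, ENNReal.ofReal (W (l ^ i * ‖h‖)) ^ (1 - p) * ∫⁻ x, V i h x ^ p ∂ν := by
      calc ∫⁻ x, G h x ^ p ∂ν
          ≤ ∫⁻ x, S ^ (p - 1) *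
            ∑' i, ENNReal.ofReal (W (l ^ i * ‖h‖)) ^ (1 - p) * V i h x ^ p ∂ν := by
            refine lintegral_mono fun x => ?_
            refine (ENNReal.rpow_le_rpow (hG h x) (by linarith)).trans ?_
            refine (rpow_tsum_le hp (fun i => ENNReal.ofReal (W (l ^ i * ‖h‖))) _
              (fun i => by simpa using hWpos i) (fun i => ENNReal.ofReal_ne_top)).trans ?_
            gcongr
            exact hSle _ hr
        _ = _ := by
            rw [lintegral_const_mul' _ _ (ENNReal.rpow_ne_top_of_nonneg (by linarith) hS),
              lintegral_tsum (fun i => (((hV i h).pow_const p).const_mul _).aemeasurable)]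
            congr 2
            ext i
            rw [lintegral_const_mul _ ((hV i h).pow_const p)]
    calc _ ≤ ENNReal.ofReal (‖h‖ ^ (-((d : ℝ) + p * β))) * (S ^ (p - 1) *
        ∑' i, ENNReal.ofReal (W (l ^ i * ‖h‖)) ^ (1 - p) *
          (C * ENNReal.ofReal (min 1 ((l ^ i * ‖h‖) ^ k)) ^ p * B i)) := by
          gcongr
          refine h1.trans ?_
          gcongr with i
          exact hVB i h
      _ = _ := by
          rw [mul_left_comm, mul_assoc (S ^ (p - 1)) C, ← ENNReal.tsum_mul_left]
          congr 1
          rw [← ENNReal.tsum_mul_left]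
          refine tsum_congr fun i => ?_
          have e1 : min 1 ((l ^ i * ‖h‖) ^ k) = (l ^ i * ‖h‖) ^ β * W (l ^ i * ‖h‖) := by
            rw [hW]
            simp only
            rw [mul_min_of_nonneg _ _ (by positivity), ← Real.rpow_add (hu i),
              ← Real.rpow_add (hu i), min_comm]
            simp
          have e2 : ENNReal.ofReal (‖h‖ ^ (-((d : ℝ) + p * β))) *
              (ENNReal.ofReal (W (l ^ i * ‖h‖)) ^ (1 - p) *
              ENNReal.ofReal (min 1 ((l ^ i * ‖h‖) ^ k)) ^ p) =
              ENNReal.ofReal ((l ^ i) ^ (β * p)) *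
                ENNReal.ofReal (W (l ^ i * ‖h‖) * ‖h‖ ^ (-(d : ℝ))) := by
            rw [e1, ENNReal.ofReal_rpow_of_pos (hWpos i),
              ENNReal.ofReal_rpow_of_nonneg (mul_nonneg (by positivity) (hWpos i).le)
                (by linarith),
              ← ENNReal.ofReal_mul (Real.rpow_nonneg (hWpos i).le _),
              ← ENNReal.ofReal_mul (by positivity), ← ENNReal.ofReal_mul (by positivity)]
            congr 1
            generalize hw : W (l ^ i * ‖h‖) = w
            have hw0 : 0 < w := hw ▸ hWpos i
            rw [Real.mul_rpow (by positivity) hw0.le, ← Real.rpow_mul (by positivity),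
              Real.mul_rpow (by positivity) (by positivity), neg_add, Real.rpow_add hr,
              Real.rpow_sub hw0, Real.rpow_one, mul_comm p β, Real.rpow_neg hr.le (β * p)]
            field_simp
          calc _ = C * B i * (ENNReal.ofReal (‖h‖ ^ (-((d : ℝ) + p * β))) *
              (ENNReal.ofReal (W (l ^ i * ‖h‖)) ^ (1 - p) *
              ENNReal.ofReal (min 1 ((l ^ i * ‖h‖) ^ k)) ^ p)) := by ring
            _ = _ := by rw [e2]; ring
  have hWm : ∀ i : ℕ, Measurable fun h : E =>
      ENNReal.ofReal (W (l ^ i * ‖h‖) * ‖h‖ ^ (-(d : ℝ))) := by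
    intro i
    simp only [hW]
    fun_prop
  calc _ ≤ ∫⁻ h, S ^ (p - 1) * C * ∑' i, ENNReal.ofReal ((l ^ i) ^ (β * p)) * B i *
        ENNReal.ofReal (W (l ^ i * ‖h‖) * ‖h‖ ^ (-(d : ℝ))) ∂μ := by
        refine lintegral_mono_ae ?_
        have : ∀ᵐ h ∂μ, h ≠ 0 := by
          simp [ae_iff]
        filter_upwards [this] with h hh using hpt h hh
    _ = S ^ (p - 1) * C * ∑' i, ENNReal.ofReal ((l ^ i) ^ (β * p)) * B i * J := by
        rw [lintegral_const_mul _ (Measurable.tsum fun i => (hWm i).const_mul _),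
          lintegral_tsum (fun i => ((hWm i).const_mul _).aemeasurable)]
        congr 2
        ext i
        rw [lintegral_const_mul _ (hWm i), hscale]
    _ = _ := by
        rw [ENNReal.tsum_mul_right]; ring

theorem exists_tsum_lintegral_le_weight {l β p N : ℝ} (hl : 1 < l) (hβ : 0 < β) (hp : 1 ≤ p)
    (hN : (Module.finrank ℝ E : ℝ) + p * β < N) :
    ∃ A : ℝ≥0∞, A ≠ ⊤ ∧ ∀ D : E → ℝ≥0∞, Measurable D →
      ∑' i : ℕ, ENNReal.ofReal ((l ^ i) ^ (β * p)) *
          ∫⁻ h, ENNReal.ofReal ((1 + ‖h‖) ^ (-N)) * D ((l ^ i)⁻¹ • h) ∂μ ≤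
        A * ∫⁻ h, ENNReal.ofReal (‖h‖ ^ (-((Module.finrank ℝ E : ℝ) + p * β))) * D h ∂μ := by
  set d := Module.finrank ℝ E with hd
  have hc0 : 0 < (d : ℝ) + p * β := by positivity
  obtain ⟨S, hS, hSle⟩ := exists_tsum_min_rpow_le hl hc0 (sub_pos.2 hN)
  have hl0 : 0 < l := by linarith
  refine ⟨S, hS, fun D hD => ?_⟩
  have e1 : ∀ i : ℕ, ENNReal.ofReal ((l ^ i) ^ (β * p)) *
      ∫⁻ h, ENNReal.ofReal ((1 + ‖h‖) ^ (-N)) * D ((l ^ i)⁻¹ • h) ∂μ =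
      ∫⁻ h, ENNReal.ofReal ((l ^ i) ^ (β * p)) * (ENNReal.ofReal ((l ^ i) ^ d) *
        (ENNReal.ofReal ((1 + l ^ i * ‖h‖) ^ (-N)) * D h)) ∂μ := by
    intro i
    rw [lintegral_eq_mul_comp_smul μ _ (c := l ^ i) (by positivity),
      ← lintegral_const_mul' _ _ ENNReal.ofReal_ne_top,
      ← lintegral_const_mul' _ _ ENNReal.ofReal_ne_top]
    congr 1
    ext h
    rw [inv_smul_smul₀ (by positivity), norm_smul, Real.norm_of_nonneg (by positivity)]
  simp_rw [e1]
  rw [← lintegral_tsum (fun i => by fun_prop), ← lintegral_const_mul _ (by fun_prop)]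
  refine lintegral_mono_ae ?_
  have : ∀ᵐ h ∂μ, h ≠ 0 := by
    simp [ae_iff]
  filter_upwards [this] with h hh
  have hr : 0 < ‖h‖ := norm_pos_iff.2 hh
  have hb : ∀ i : ℕ, ENNReal.ofReal ((l ^ i) ^ (β * p)) * (ENNReal.ofReal ((l ^ i) ^ d) *
        (ENNReal.ofReal ((1 + l ^ i * ‖h‖) ^ (-N)) * D h)) ≤
      ENNReal.ofReal (min ((l ^ i * ‖h‖) ^ ((d : ℝ) + p * β))
        ((l ^ i * ‖h‖) ^ (-(N - ((d : ℝ) + p * β))))) *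
        (ENNReal.ofReal (‖h‖ ^ (-((d : ℝ) + p * β))) * D h) := by
    intro i
    rw [← mul_assoc, ← mul_assoc, ← mul_assoc, ← ENNReal.ofReal_mul (by positivity),
      ← ENNReal.ofReal_mul (by positivity), ← ENNReal.ofReal_mul (by positivity)]
    refine mul_le_mul_left (ENNReal.ofReal_le_ofReal ?_) _
    have hu : 0 < l ^ i * ‖h‖ := by positivity
    have e2 : (l ^ i) ^ (β * p) * (l ^ i) ^ d =
        (l ^ i * ‖h‖) ^ ((d : ℝ) + p * β) * ‖h‖ ^ (-((d : ℝ) + p * β)) := by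
      rw [Real.mul_rpow (by positivity) (by positivity), mul_assoc, ← Real.rpow_add hr,
        add_neg_cancel, Real.rpow_zero, mul_one, Real.rpow_add (by positivity), Real.rpow_natCast,
        mul_comm β p, mul_comm]
    rw [e2, mul_right_comm]
    refine mul_le_mul_of_nonneg_right ?_ (by positivity)
    refine le_min ?_ ?_
    · refine mul_le_of_le_one_right (by positivity) ?_
      apply Real.rpow_le_one_of_one_le_of_nonpos
      · linarith
      · linarith
    · rw [show -(N - ((d : ℝ) + p * β)) = ((d : ℝ) + p * β) + -N by ring,
        Real.rpow_add hu _ (-N)]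
      gcongr ?_ * ?_
      apply Real.rpow_le_rpow_of_nonpos hu (by linarith) (by linarith)
  refine (ENNReal.tsum_le_tsum hb).trans ?_
  rw [ENNReal.tsum_mul_right]
  gcongr
  exact hSle _ hr

end abstract

section nice
variable {n : ℕ}

instance isAddHaarMeasure_volume_Rn1 : (volume : Measure (Rn1 n)).IsAddHaarMeasure :=
  inferInstanceAs ((volume : Measure (Rn n)).prod (volume : Measure ℝ)).IsAddHaarMeasure

/-- A continuous, integrable and bounded function. -/
structure IsNice (g : Rn1 n → ℂ) : Prop where
  cont : Continuous g
  int : Integrable g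
  bdd : ∃ M, ∀ x, ‖g x‖ ≤ M

theorem SchwartzMap.isNice (f : SchwartzMap (Rn1 n) ℂ) : IsNice (f : Rn1 n → ℂ) where
  cont := f.continuous
  int := f.integrable
  bdd := by
    obtain ⟨C, -, hC⟩ := f.decay 0 0
    exact ⟨C, fun x => by simpa using hC x⟩

theorem IsNice.add {f g : Rn1 n → ℂ} (hf : IsNice f) (hg : IsNice g) :
    IsNice (fun x => f x + g x) where
  cont := hf.cont.add hg.cont
  int := hf.int.add hg.int
  bdd := by
    obtain ⟨M, hM⟩ := hf.bdd
    obtain ⟨N, hN⟩ := hg.bdd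
    exact ⟨M + N, fun x => norm_add_le_of_le (hM x) (hN x)⟩

theorem IsNice.const_mul {f : Rn1 n → ℂ} (hf : IsNice f) (c : ℂ) :
    IsNice (fun x => c * f x) where
  cont := hf.cont.const_mul c
  int := hf.int.const_mul c
  bdd := by
    obtain ⟨M, hM⟩ := hf.bdd
    exact ⟨‖c‖ * M, fun x => by rw [norm_mul]; gcongr; exact hM x⟩

theorem IsNice.sub {f g : Rn1 n → ℂ} (hf : IsNice f) (hg : IsNice g) :
    IsNice (fun x => f x - g x) := by
  simpa [sub_eq_add_neg] using hf.add (hg.const_mul (-1))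

theorem conv1_eq_convolution (g f : Rn1 n → ℂ) :
    conv1 g f = convolution f g (ContinuousLinearMap.mul ℂ ℂ) volume := by
  ext x
  simp only [conv1, convolution, ContinuousLinearMap.mul_apply', mul_comm]

theorem conv1_eq_integral_sub (g f : Rn1 n → ℂ) (x : Rn1 n) :
    conv1 g f x = ∫ y, g y * f (x - y) := by
  rw [conv1, ← integral_sub_left_eq_self _ _ x]
  simp

theorem IsNice.integrable_mul_sub {g f : Rn1 n → ℂ} (hg : IsNice g) (hf : IsNice f) (x : Rn1 n) :
    Integrable fun y => g y * f (x - y) := by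
  obtain ⟨M, hM⟩ := hf.bdd
  exact hg.int.mul_bdd (c := M) (hf.cont.comp (by fun_prop)).aestronglyMeasurable
    (Filter.Eventually.of_forall fun y => hM _)

theorem IsNice.conv1 {g f : Rn1 n → ℂ} (hg : IsNice g) (hf : IsNice f) : IsNice (conv1 g f) where
  cont := by
    rw [conv1_eq_convolution]
    obtain ⟨M, hM⟩ := hg.bdd
    exact BddAbove.continuous_convolution_right_of_integrable _
      ⟨M, by rintro _ ⟨x, rfl⟩; exact hM x⟩ hf.int hg.cont
  int := by
    rw [conv1_eq_convolution]
    exact hf.int.integrable_convolution _ hg.int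
  bdd := by
    obtain ⟨M, hM⟩ := hf.bdd
    refine ⟨∫ y, ‖g y‖ * M, fun x => ?_⟩
    rw [conv1_eq_integral_sub]
    refine norm_integral_le_of_norm_le (hg.int.norm.mul_const M) (Filter.Eventually.of_forall ?_)
    intro y
    simp only [norm_mul]
    gcongr
    exact hM _

end nice

section fourier
variable {n : ℕ}
open scoped FourierTransform

theorem integral_comp_ofLp (f : Rn1 n → ℂ) :
    ∫ v : WithLp 2 (Rn1 n), f v.ofLp = ∫ x, f x :=
  (WithLp.volume_preserving_symm_measurableEquiv_toLp_prod (Rn n) ℝ).integral_comp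
    (MeasurableEquiv.measurableEmbedding _) f

theorem FT1_eq_fourier (f : Rn1 n → ℂ) (q : Rn1 n) :
    FT1 f q = 𝓕 (fun v : WithLp 2 (Rn1 n) => f v.ofLp) (WithLp.toLp 2 q) := by
  rw [Real.fourier_eq', FT1, ← integral_comp_ofLp]
  congr 1
  ext v
  rw [smul_eq_mul, WithLp.prod_inner_apply]
  congr 2
  simp [PiLp.inner_apply, mul_comm]
  ring

theorem integrable_comp_ofLp {f : Rn1 n → ℂ} (hf : Integrable f) :
    Integrable (fun v : WithLp 2 (Rn1 n) => f v.ofLp) :=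
  (WithLp.volume_preserving_ofLp (Rn n) ℝ).integrable_comp_of_integrable hf

theorem FT1_conv1 {g f : Rn1 n → ℂ} (hg : Integrable g) (hf : Integrable f) (q : Rn1 n) :
    FT1 (conv1 g f) q = FT1 g q * FT1 f q := by
  rw [FT1_eq_fourier, FT1_eq_fourier, FT1_eq_fourier, mul_comm,
    ← Real.fourier_mul_convolution_eq (integrable_comp_ofLp hf) (integrable_comp_ofLp hg)]
  refine congrFun (congrArg _ (funext fun v => ?_)) _
  rw [conv1_eq_convolution]
  exact (integral_comp_ofLp fun y => f y * g (v.ofLp - y)).symm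

theorem IsNice.ext_FT1 {f g : Rn1 n → ℂ} (hf : IsNice f) (hg : IsNice g)
    (h : ∀ q, FT1 f q = FT1 g q) : f = g := by
  have hd := hf.sub hg
  have h0 : 𝓕 (fun v : WithLp 2 (Rn1 n) => f v.ofLp - g v.ofLp) = 0 := by
    funext q
    have h2 := h q.ofLp
    rw [FT1_eq_fourier, FT1_eq_fourier, Real.fourier_eq, Real.fourier_eq, ← sub_eq_zero,
      ← integral_sub] at h2
    · rw [Real.fourier_eq]
      simpa [smul_sub] using h2
    · exact (Real.fourierIntegral_convergent_iff _).2 (integrable_comp_ofLp hf.int)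
    · exact (Real.fourierIntegral_convergent_iff _).2 (integrable_comp_ofLp hg.int)
  have h1 := Continuous.fourierInv_fourier_eq (f := fun v : WithLp 2 (Rn1 n) => f v.ofLp - g v.ofLp)
    (hd.cont.comp (WithLp.prod_continuous_ofLp 2 _ _)) (integrable_comp_ofLp hd.int)
    (by rw [h0]; exact integrable_zero _ _ _)
  ext x
  have := congrFun h1 (WithLp.toLp 2 x)
  rw [h0, Real.fourierInv_eq] at this
  simp only [Pi.zero_apply, smul_zero, integral_zero] at this
  exact (sub_eq_zero.1 this.symm)

end fourier

section dilation
variable {n : ℕ}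

/-- The parabolic dilation `(X, t) ↦ (rX, r²t)`. -/
def pdil (r : ℝ) (x : Rn1 n) : Rn1 n := (r • x.1, r ^ 2 * x.2)

/-- The `L¹`-normalised parabolic dilate `r^{n+2} K(rX, r²t)`. -/
def pscale (r : ℝ) (K : Rn1 n → ℂ) (x : Rn1 n) : ℂ := ((r ^ (n + 2) : ℝ) : ℂ) * K (pdil r x)

/-- Reflection in the space variable. -/
def xrefl (K : Rn1 n → ℂ) (x : Rn1 n) : ℂ := K (-x.1, x.2)

theorem continuous_pdil (r : ℝ) : Continuous (pdil r : Rn1 n → Rn1 n) := by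
  unfold pdil; fun_prop

theorem pdil_pdil (r s : ℝ) (x : Rn1 n) : pdil r (pdil s x) = pdil (r * s) x := by
  simp [pdil, smul_smul, mul_pow, mul_assoc]

theorem pdil_one (x : Rn1 n) : pdil 1 x = x := by simp [pdil]

theorem pdil_sub (r : ℝ) (x y : Rn1 n) : pdil r (x - y) = pdil r x - pdil r y := by
  simp [pdil, smul_sub, mul_sub]

theorem pdil_add (r : ℝ) (x y : Rn1 n) : pdil r (x + y) = pdil r x + pdil r y := by
  simp [pdil, mul_add]

theorem map_pdil {r : ℝ} (hr : 0 < r) :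
    Measure.map (pdil r : Rn1 n → Rn1 n) volume = ENNReal.ofReal (r ^ (n + 2))⁻¹ • volume := by
  have h1 := Measure.map_addHaar_smul (volume : Measure (Rn n)) hr.ne'
  have h2 := Measure.map_addHaar_smul (volume : Measure ℝ) (pow_pos hr 2).ne'
  change Measure.map (Prod.map (fun X : Rn n => r • X) (fun t : ℝ => r ^ 2 * t))
    ((volume : Measure (Rn n)).prod (volume : Measure ℝ)) =
    ENNReal.ofReal (r ^ (n + 2))⁻¹ • ((volume : Measure (Rn n)).prod (volume : Measure ℝ))
  rw [← Measure.map_prod_map _ _ (by fun_prop) (by fun_prop)]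
  change (Measure.map (r • ·) volume).prod (Measure.map (r ^ 2 • ·) volume) = _
  rw [h1, h2, Measure.prod_smul_left, Measure.prod_smul_right, smul_smul,
    ← ENNReal.ofReal_mul (by positivity), abs_of_pos (by positivity), abs_of_pos (by positivity)]
  simp [finrank_euclideanSpace, pow_add, mul_comm]

theorem measurableEmbedding_pdil {r : ℝ} (hr : 0 < r) :
    MeasurableEmbedding (pdil r : Rn1 n → Rn1 n) :=
  ((Homeomorph.smulOfNeZero r hr.ne' (α := Rn n)).prodCongr
    (Homeomorph.smulOfNeZero (r ^ 2) (pow_pos hr 2).ne' (α := ℝ))).measurableEmbedding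

theorem lintegral_comp_pdil (F : Rn1 n → ℝ≥0∞) {r : ℝ} (hr : 0 < r) :
    ∫⁻ x, F (pdil r x) = ENNReal.ofReal (r ^ (n + 2))⁻¹ * ∫⁻ x, F x := by
  rw [← (measurableEmbedding_pdil hr).lintegral_map, map_pdil hr, lintegral_smul_measure,
    smul_eq_mul]

theorem integral_comp_pdil (F : Rn1 n → ℂ) {r : ℝ} (hr : 0 < r) :
    ((r ^ (n + 2) : ℝ) : ℂ) * ∫ x, F (pdil r x) = ∫ x, F x := by
  rw [← (measurableEmbedding_pdil hr).integral_map, map_pdil hr, integral_smul_measure,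
    ENNReal.toReal_ofReal (by positivity), Complex.real_smul, ← mul_assoc, ← Complex.ofReal_mul,
    mul_inv_cancel₀ (by positivity), Complex.ofReal_one, one_mul]

theorem IsNice.comp_pdil {g : Rn1 n → ℂ} (hg : IsNice g) {r : ℝ} (hr : 0 < r) :
    IsNice (fun x => g (pdil r x)) where
  cont := hg.cont.comp (continuous_pdil r)
  int := by
    change Integrable (g ∘ pdil r)
    rw [← (measurableEmbedding_pdil hr).integrable_map_iff, map_pdil hr]
    exact hg.int.smul_measure ENNReal.ofReal_ne_top
  bdd := hg.bdd.imp fun M hM x => hM _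

theorem IsNice.pscale {g : Rn1 n → ℂ} (hg : IsNice g) {r : ℝ} (hr : 0 < r) :
    IsNice (pscale r g) := (hg.comp_pdil hr).const_mul _

theorem measurePreserving_xneg :
    MeasurePreserving (fun x : Rn1 n => ((-x.1, x.2) : Rn1 n)) :=
  (Measure.measurePreserving_neg (volume : Measure (Rn n))).prod
    (MeasurePreserving.id (volume : Measure ℝ))

theorem measurableEmbedding_xneg :
    MeasurableEmbedding (fun x : Rn1 n => ((-x.1, x.2) : Rn1 n)) :=
  ((Homeomorph.neg (Rn n)).prodCongr (Homeomorph.refl ℝ)).measurableEmbedding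

theorem IsNice.xrefl {g : Rn1 n → ℂ} (hg : IsNice g) : IsNice (xrefl g) where
  cont := hg.cont.comp (by fun_prop)
  int := measurePreserving_xneg.integrable_comp_of_integrable hg.int
  bdd := hg.bdd.imp fun M hM x => hM _

theorem FT1_pscale (K : Rn1 n → ℂ) {r : ℝ} (hr : 0 < r) (q : Rn1 n) :
    FT1 (pscale r K) q = FT1 K (pdil r⁻¹ q) := by
  rw [FT1]
  conv_rhs => rw [FT1, ← integral_comp_pdil _ hr, ← integral_const_mul]
  congr 1
  ext x
  have e : (∑ k, x.1 k * q.1 k) + x.2 * q.2 =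
      (∑ k, (pdil r x).1 k * (pdil r⁻¹ q).1 k) + (pdil r x).2 * (pdil r⁻¹ q).2 := by
    simp only [pdil, PiLp.smul_apply, smul_eq_mul]
    congr 1
    · refine Finset.sum_congr rfl fun k _ => ?_
      field_simp
    · field_simp
  rw [pscale, mul_left_comm, e]

theorem FT1_xrefl (K : Rn1 n → ℂ) (q : Rn1 n) :
    FT1 (xrefl K) q = FT1 K (-q.1, q.2) := by
  rw [FT1, FT1, ← measurePreserving_xneg.integral_comp measurableEmbedding_xneg]
  congr 1
  ext x
  simp [xrefl]

theorem conv1_pscale (K f : Rn1 n → ℂ) {r : ℝ} (hr : 0 < r) (x : Rn1 n) :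
    conv1 (pscale r K) f x = conv1 K (fun y => f (pdil r⁻¹ y)) (pdil r x) := by
  rw [conv1_eq_integral_sub]
  conv_rhs => rw [conv1_eq_integral_sub, ← integral_comp_pdil _ hr, ← integral_const_mul]
  congr 1
  ext y
  rw [← pdil_sub, pdil_pdil, inv_mul_cancel₀ hr.ne', pdil_one, pscale, mul_assoc]

theorem integral_eq_FT1_zero (K : Rn1 n → ℂ) : ∫ x, K x = FT1 K 0 := by
  simp [FT1]

theorem FT1_add {f g : Rn1 n → ℂ} (hf : IsNice f) (hg : IsNice g) (q : Rn1 n) :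
    FT1 (fun x => f x + g x) q = FT1 f q + FT1 g q := by
  have key : ∀ {h : Rn1 n → ℂ}, IsNice h → Integrable fun p : Rn1 n =>
      Complex.exp (-(2 * (π : ℂ) * Complex.I) *
        (((∑ k, p.1 k * q.1 k) + p.2 * q.2 : ℝ) : ℂ)) * h p := by
    intro h hh
    refine hh.int.bdd_mul (c := 1) (Continuous.aestronglyMeasurable (by fun_prop))
      (Filter.Eventually.of_forall fun x => ?_)
    rw [Complex.norm_exp]
    simp
  simp only [FT1, mul_add]
  exact integral_add (key hf) (key hg)

theorem FT1_const_mul (f : Rn1 n → ℂ) (c : ℂ) (q : Rn1 n) :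
    FT1 (fun x => c * f x) q = c * FT1 f q := by
  simp only [FT1, mul_left_comm _ c]
  exact integral_const_mul _ _

end dilation

section littlewoodPaley
variable {n : ℕ}

/-- The parabolic size `|ξ| + |τ|^{1/2}`. -/
def psz (q : Rn1 n) : ℝ := ‖q.1‖ + |q.2| ^ ((1 : ℝ) / 2)

theorem psz_pdil {r : ℝ} (hr : 0 < r) (q : Rn1 n) : psz (pdil r q) = r * psz q := by
  simp only [psz, pdil]
  rw [norm_smul, abs_mul, Real.mul_rpow (by positivity) (by positivity), abs_of_pos (by positivity),
    ← Real.sqrt_eq_rpow, Real.sqrt_sq hr.le, Real.norm_of_nonneg hr.le, mul_add]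

namespace ParabolicLP
variable (P : ParabolicLP n)

theorem FT1_phi_eq_zero_of_le {q : Rn1 n} (h : psz q ≤ 1 / 2) : FT1 P.φ q = 0 :=
  P.ft_supp q fun h' => absurd h'.1 (not_lt.2 h)

theorem FT1_phi_eq_zero_of_ge {q : Rn1 n} (h : 2 ≤ psz q) : FT1 P.φ q = 0 :=
  P.ft_supp q fun h' => absurd h'.2 (not_lt.2 h)

theorem FT1_psi (q : Rn1 n) :
    FT1 P.ψ q = 1 - ∑' i : ℕ, FT1 P.φ (pdil ((2 : ℝ) ^ (-((i : ℤ) + 1))) q) := by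
  rw [P.ft_psi]
  congr 2
  ext i
  rw [pdil, ← zpow_natCast, ← zpow_mul, mul_comm (-((i : ℤ) + 1)), mul_neg]
  rfl

theorem FT1_psi_of_le {q : Rn1 n} (h : psz q ≤ 1) : FT1 P.ψ q = 1 := by
  have h0 : ∀ i : ℕ, FT1 P.φ (pdil ((2 : ℝ) ^ (-((i : ℤ) + 1))) q) = 0 := by
    intro i
    apply P.FT1_phi_eq_zero_of_le
    have := one_le_pow₀ (one_le_two (α := ℝ)) (n := i)
    rw [psz_pdil (by positivity), zpow_neg, inv_mul_le_iff₀ (by positivity),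
      zpow_add₀ (by norm_num),
      zpow_natCast]
    linarith
  rw [FT1_psi]
  simp_rw [h0]
  simp

theorem summable_FT1_phi (q : Rn1 n) :
    Summable fun i : ℕ => FT1 P.φ (pdil ((2 : ℝ) ^ (-(i : ℤ))) q) := by
  obtain ⟨N, hN⟩ := pow_unbounded_of_one_lt (2 * psz q) one_lt_two
  refine summable_of_ne_finset_zero (s := Finset.range N) fun i hi => ?_
  have hi : N ≤ i := by simpa using hi
  apply P.FT1_phi_eq_zero_of_le
  have := pow_le_pow_right₀ (one_le_two (α := ℝ)) hi
  rw [psz_pdil (by positivity), zpow_neg, zpow_natCast, inv_mul_le_iff₀ (by positivity)]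
  linarith

theorem FT1_psi_of_ge {q : Rn1 n} (h : 2 ≤ psz q) : FT1 P.ψ q = 0 := by
  have hq : q ≠ 0 := by
    rintro rfl
    norm_num [psz] at h
  have h1 := P.ft_sum q hq
  have hinj : Function.Injective fun i : ℕ => (i : ℤ) + 1 := fun i j hij => by simpa using hij
  rw [← hinj.tsum_eq] at h1
  · rw [P.ft_psi, h1, sub_self]
  · intro i hi
    by_contra hi'
    refine hi ?_
    have hi0 : i ≤ 0 := by
      by_contra! h0
      exact hi' ⟨(i - 1).toNat, by simp; omega⟩
    have e : ((2 : ℝ) ^ (-i) • q.1, (2 : ℝ) ^ (-(2 * i)) * q.2) = pdil ((2 : ℝ) ^ (-i)) q := by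
      rw [pdil, ← zpow_natCast, ← zpow_mul, mul_comm (-i), mul_neg]
      rfl
    simp only [e]
    apply P.FT1_phi_eq_zero_of_ge
    rw [psz_pdil (by positivity)]
    have := one_le_zpow₀ (one_le_two (α := ℝ)) (neg_nonneg.2 hi0)
    nlinarith

theorem FT1_phi (q : Rn1 n) : FT1 P.φ q = FT1 P.ψ q - FT1 P.ψ (pdil 2 q) := by
  have h := (P.summable_FT1_phi q).tsum_eq_zero_add
  have e : ∀ i : ℕ, pdil ((2 : ℝ) ^ (-((i : ℤ) + 1))) (pdil 2 q) =
    pdil ((2 : ℝ) ^ (-(i : ℤ))) q := by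
    intro i
    rw [pdil_pdil, neg_add, zpow_add₀ (by norm_num)]
    simp
  rw [FT1_psi, FT1_psi]
  simp_rw [e]
  rw [h]
  simp [pdil_one]

theorem lpPhi_eq (i : ℕ) : lpPhi P i = pscale (2 ^ i) P.φ := by
  ext x
  simp only [lpPhi, pscale, pdil, ← pow_mul, mul_comm i 2]

theorem phi_eq : (P.φ : Rn1 n → ℂ) = fun x => P.ψ x - pscale 2⁻¹ P.ψ x := by
  have h2 : (0 : ℝ) < 2⁻¹ := by norm_num
  refine P.φ.isNice.ext_FT1 (P.ψ.isNice.sub (P.ψ.isNice.pscale h2)) fun q => ?_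
  have := FT1_add P.ψ.isNice ((P.ψ.isNice.pscale h2).const_mul (-1)) q
  simp only [sub_eq_add_neg, neg_eq_neg_one_mul (pscale _ _ _)]
  rw [this, FT1_const_mul, FT1_pscale _ h2, FT1_phi, inv_inv]
  ring

theorem lpPhi_succ (i : ℕ) (x : Rn1 n) :
    lpPhi P (i + 1) x = pscale (2 ^ (i + 1)) P.ψ x - pscale (2 ^ i) P.ψ x := by
  rw [lpPhi_eq, pscale, phi_eq]
  simp only [pscale, pdil_pdil]
  rw [mul_sub, ← mul_assoc, ← Complex.ofReal_mul, ← mul_pow, mul_comm 2⁻¹, pow_succ (2 : ℝ) i,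
    mul_inv_cancel_right₀ two_ne_zero]

theorem integral_psi : ∫ x, P.ψ x = 1 := by
  rw [integral_eq_FT1_zero]
  exact P.FT1_psi_of_le (by simp [psz])

theorem conv1_pscale_two_psi {K f : Rn1 n → ℂ} (hK : IsNice K) (hf : IsNice f)
    (h : ∀ q, 2 ≤ psz q → FT1 K q = 0) :
    conv1 (pscale 2 P.ψ) (conv1 K f) = conv1 K f := by
  have h2 : (0 : ℝ) < 2 := by norm_num
  have hP := P.ψ.isNice.pscale h2
  refine (hP.conv1 (hK.conv1 hf)).ext_FT1 (hK.conv1 hf) fun q => ?_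
  rw [FT1_conv1 hP.int (hK.conv1 hf).int, FT1_pscale _ h2, FT1_conv1 hK.int hf.int]
  rcases le_total 2 (psz q) with hq | hq
  · rw [h q hq]; simp
  · rw [P.FT1_psi_of_le, one_mul]
    rw [psz_pdil (by norm_num)]
    linarith

/-- A spatially even low-pass kernel of unit mass whose symbol is disjoint from that of `φ`. -/
def evenKer (x : Rn1 n) : ℂ := (1 / 2) * (pscale 4⁻¹ P.ψ x + xrefl (pscale 4⁻¹ P.ψ) x)

theorem isNice_evenKer : IsNice P.evenKer :=
  ((P.ψ.isNice.pscale (by norm_num)).add (P.ψ.isNice.pscale (by norm_num)).xrefl).const_mul _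

theorem FT1_evenKer (q : Rn1 n) :
    FT1 P.evenKer q = (1 / 2) * (FT1 P.ψ (pdil 4 q) + FT1 P.ψ (pdil 4 (-q.1, q.2))) := by
  have hP := P.ψ.isNice.pscale (r := 4⁻¹) (by norm_num)
  unfold evenKer
  rw [FT1_const_mul, FT1_add hP hP.xrefl, FT1_xrefl, FT1_pscale _ (by norm_num),
    FT1_pscale _ (by norm_num), inv_inv]

theorem integral_evenKer : ∫ x, P.evenKer x = 1 := by
  have h0 : FT1 P.ψ 0 = 1 := P.FT1_psi_of_le (by simp [psz])
  rw [integral_eq_FT1_zero, FT1_evenKer]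
  have e : pdil 4 (0 : Rn1 n) = 0 := by simp [pdil]
  have e' : ((-(0 : Rn1 n).1, (0 : Rn1 n).2) : Rn1 n) = 0 := by simp
  rw [e', e, h0]
  norm_num

theorem evenKer_neg (Y : Rn n) (t : ℝ) : P.evenKer (-Y, t) = P.evenKer (Y, t) := by
  simp [evenKer, xrefl, add_comm]

theorem conv1_phi_evenKer {g : Rn1 n → ℂ} (hg : IsNice g) :
    conv1 P.φ (conv1 P.evenKer g) = 0 := by
  have h0 : IsNice (0 : Rn1 n → ℂ) := ⟨continuous_zero, integrable_zero _ _ _, 0, by simp⟩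
  refine (P.φ.isNice.conv1 (P.isNice_evenKer.conv1 hg)).ext_FT1 h0 fun q => ?_
  rw [FT1_conv1 P.φ.isNice.int (P.isNice_evenKer.conv1 hg).int,
    FT1_conv1 P.isNice_evenKer.int hg.int, FT1_evenKer]
  have e0 : FT1 (0 : Rn1 n → ℂ) q = 0 := by simp [FT1]
  rw [e0]
  rcases le_total (psz q) (1 / 2) with hq | hq
  · rw [P.FT1_phi_eq_zero_of_le hq, zero_mul]
  · have e : psz ((-q.1, q.2) : Rn1 n) = psz q := by simp [psz]
    rw [P.FT1_psi_of_ge (q := pdil 4 q) (by rw [psz_pdil (by norm_num)]; linarith),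
      P.FT1_psi_of_ge (q := pdil 4 (-q.1, q.2)) (by rw [psz_pdil (by norm_num), e]; linarith)]
    simp

end ParabolicLP

end littlewoodPaley

theorem lintegral_rpow_lintegral_mul_le {X Y : Type*} [MeasurableSpace X] [MeasurableSpace Y]
    (μ : Measure X) (ν : Measure Y) [SFinite μ] [SFinite ν] {p : ℝ} (hp : 1 ≤ p) {k : Y → ℝ≥0∞}
    (hk : Measurable k) {F : Y → X → ℝ≥0∞} (hF : Measurable (Function.uncurry F)) :
    ∫⁻ x, (∫⁻ y, k y * F y x ∂ν) ^ p ∂μ ≤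
      (∫⁻ y, k y ∂ν) ^ (p - 1) * ∫⁻ y, k y * ∫⁻ x, F y x ^ p ∂μ ∂ν := by
  have hFx : ∀ x, Measurable fun y => F y x := fun x => hF.comp measurable_prodMk_right
  have hFy : ∀ y, Measurable fun x => F y x := fun y => hF.comp measurable_prodMk_left
  have hm : Measurable (Function.uncurry fun x y => k y * F y x ^ p) :=
    (hk.comp measurable_snd).mul ((hF.comp measurable_swap).pow_const p)
  calc _ ≤ ∫⁻ x, (∫⁻ y, k y ∂ν) ^ (p - 1) * ∫⁻ y, k y * F y x ^ p ∂ν ∂μ :=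
        lintegral_mono fun x => rpow_lintegral_mul_le ν hp hk.aemeasurable (hFx x).aemeasurable
    _ = _ := by
        rw [lintegral_const_mul _ hm.lintegral_prod_right, lintegral_lintegral_swap hm.aemeasurable]
        congr 1
        refine lintegral_congr fun y => ?_
        rw [lintegral_const_mul _ ((hFy y).pow_const p)]

section smooth
variable {E F : Type*} [NormedAddCommGroup E] [NormedSpace ℝ E] [NormedAddCommGroup F]
  [NormedSpace ℝ F]

theorem norm_comp_add_sub_le_of_norm_fderiv_le {g : E → F} (hg : Differentiable ℝ g) {C : ℝ} {k : ℕ}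
    (hC : ∀ z, ‖fderiv ℝ g z‖ ≤ C * ((1 + ‖z‖) ^ k)⁻¹) (y : E) {h : E} (hh : ‖h‖ ≤ 1) :
    ‖g (y + h) - g y‖ ≤ 2 ^ k * C * ‖h‖ * ((1 + ‖y‖) ^ k)⁻¹ := by
  have hC0 : 0 ≤ C := by simpa using (norm_nonneg _).trans (hC 0)
  have := (convex_closedBall y 1).norm_image_sub_le_of_norm_fderiv_le (𝕜 := ℝ) (f := g)
    (C := 2 ^ k * C * ((1 + ‖y‖) ^ k)⁻¹) (x := y) (y := y + h) (fun x _ => hg x) (fun z hz => ?_)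
    (by simp) (by simpa using hh)
  · calc _ ≤ _ := this
      _ = _ := by rw [add_sub_cancel_left]; ring
  · refine (hC z).trans ?_
    have hz' : ‖y‖ ≤ ‖z‖ + 1 := by
      have : ‖y - z‖ ≤ 1 := by rwa [← dist_eq_norm, dist_comm]
      linarith [norm_sub_norm_le y z]
    have h1 : (1 + ‖y‖) ^ k ≤ 2 ^ k * (1 + ‖z‖) ^ k := by
      rw [← mul_pow]
      gcongr
      linarith [norm_nonneg z]
    have h2 : ((1 + ‖z‖) ^ k)⁻¹ ≤ 2 ^ k * ((1 + ‖y‖) ^ k)⁻¹ := by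
      rw [← div_eq_mul_inv, le_div_iff₀ (by positivity), inv_mul_le_iff₀ (by positivity), mul_comm]
      exact h1
    calc C * ((1 + ‖z‖) ^ k)⁻¹ ≤ C * (2 ^ k * ((1 + ‖y‖) ^ k)⁻¹) := by gcongr
      _ = _ := by ring

theorem SchwartzMap.exists_norm_le (f : SchwartzMap E F) (k : ℕ) :
    ∃ C, ∀ x, ‖f x‖ ≤ C * ((1 + ‖x‖) ^ k)⁻¹ := by
  refine ⟨2 ^ k * ((Finset.Iic (k, 0)).sup fun m => SchwartzMap.seminorm ℝ m.1 m.2) f, fun x => ?_⟩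
  rw [← div_eq_mul_inv, le_div_iff₀ (by positivity), mul_comm]
  simpa using f.one_add_le_sup_seminorm_apply (𝕜 := ℝ) (m := (k, 0)) le_rfl le_rfl x

theorem SchwartzMap.exists_norm_add_sub_le (f : SchwartzMap E F) (k : ℕ) :
    ∃ C, ∀ y h : E, ‖h‖ ≤ 1 → ‖f (y + h) - f y‖ ≤ C * ‖h‖ * ((1 + ‖y‖) ^ k)⁻¹ := by
  obtain ⟨C, hC⟩ := (SchwartzMap.fderivCLM ℝ E F f).exists_norm_le k
  exact ⟨2 ^ k * C, fun y h hh => norm_comp_add_sub_le_of_norm_fderiv_le f.differentiable hC y hh⟩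

theorem SchwartzMap.exists_norm_second_difference_le (f : SchwartzMap E F) (k : ℕ) :
    ∃ C, ∀ y h : E, ‖h‖ ≤ 1 →
      ‖f (y + h) - (2 : ℝ) • f y + f (y - h)‖ ≤ C * ‖h‖ ^ 2 * ((1 + ‖y‖) ^ k)⁻¹ := by
  obtain ⟨C, hC⟩ := (SchwartzMap.fderivCLM ℝ E F f).exists_norm_add_sub_le k
  refine ⟨2 ^ k * C, fun y h hh => ?_⟩
  have hd : Differentiable ℝ fun z => f (z + h) - f z :=
    (f.differentiable.comp (by fun_prop)).sub f.differentiable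
  have key := norm_comp_add_sub_le_of_norm_fderiv_le hd (C := C * ‖h‖) (k := k) (fun z => ?_) y
    (h := -h) (by simpa using hh)
  · rw [← norm_neg] at key
    calc _ = _ := by congr 1; rw [two_smul, neg_add_cancel_right, ← sub_eq_add_neg]; abel
      _ ≤ _ := key
      _ = _ := by rw [norm_neg]; ring
  · rw [fderiv_fun_sub (by exact (f.differentiable.comp (by fun_prop)) z) (f.differentiable z),
      fderiv_comp_add_right]
    exact hC z h hh

variable [FiniteDimensional ℝ E] [MeasurableSpace E] [BorelSpace E] (μ : Measure E)
  [μ.IsAddHaarMeasure]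

theorem lintegral_inv_one_add_norm_pow_ne_top {k : ℕ} (hk : Module.finrank ℝ E < k) :
    ∫⁻ x, ENNReal.ofReal ((1 + ‖x‖) ^ k)⁻¹ ∂μ ≠ ⊤ := by
  have := finite_integral_one_add_norm (μ := μ) (r := (k : ℝ)) (by exact_mod_cast hk)
  refine ne_of_eq_of_ne (lintegral_congr fun x => ?_) this.ne
  rw [Real.rpow_neg (by positivity), Real.rpow_natCast]

theorem exists_lintegral_enorm_le_min_one {G : Type*} [NormedAddCommGroup G] {g : E → E → G}
    {m : ℕ} {A : ℝ≥0∞} (hA : A ≠ ⊤)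
    (h1 : ∀ h, ∫⁻ y, ‖g h y‖ₑ ∂μ ≤ A) {C : ℝ} {k : ℕ} (hk : Module.finrank ℝ E < k)
    (h2 : ∀ y h : E, ‖h‖ ≤ 1 → ‖g h y‖ ≤ C * ‖h‖ ^ m * ((1 + ‖y‖) ^ k)⁻¹) :
    ∃ B : ℝ≥0∞, B ≠ ⊤ ∧ ∀ h, ∫⁻ y, ‖g h y‖ₑ ∂μ ≤ B * ENNReal.ofReal (min 1 (‖h‖ ^ m)) := by
  refine ⟨A + ENNReal.ofReal C * ∫⁻ x, ENNReal.ofReal ((1 + ‖x‖) ^ k)⁻¹ ∂μ,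
    ENNReal.add_ne_top.2 ⟨hA, ENNReal.mul_ne_top ENNReal.ofReal_ne_top
      (lintegral_inv_one_add_norm_pow_ne_top μ hk)⟩, fun h => ?_⟩
  rw [add_mul]
  rcases le_total ‖h‖ 1 with hh | hh
  · rw [min_eq_right (pow_le_one₀ (norm_nonneg _) hh)]
    refine le_add_left ?_
    rw [mul_right_comm, ← lintegral_const_mul' _ _
      (ENNReal.mul_ne_top ENNReal.ofReal_ne_top ENNReal.ofReal_ne_top)]
    refine lintegral_mono fun y => ?_
    rw [← ofReal_norm, ← ENNReal.ofReal_mul' (by positivity), ← ENNReal.ofReal_mul' (by positivity)]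
    exact ENNReal.ofReal_le_ofReal (h2 y h hh)
  · rw [min_eq_left (one_le_pow₀ hh), ENNReal.ofReal_one, mul_one]
    exact le_add_right (h1 h)

theorem SchwartzMap.exists_lintegral_difference_le (f : SchwartzMap E F) :
    ∃ B : ℝ≥0∞, B ≠ ⊤ ∧ ∀ h, ∫⁻ y, ‖f (y + h) - f y‖ₑ ∂μ ≤
      B * ENNReal.ofReal (min 1 (‖h‖ ^ 1)) := by
  obtain ⟨C, hC⟩ := f.exists_norm_add_sub_le (Module.finrank ℝ E + 1)
  refine exists_lintegral_enorm_le_min_one μ (g := fun h y => f (y + h) - f y)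
    (A := ∫⁻ y, ‖f y‖ₑ ∂μ + ∫⁻ y, ‖f y‖ₑ ∂μ) ?_ (fun h => ?_) (Nat.lt_succ_self _)
      (by simpa using hC)
  · have := (f.integrable (μ := μ)).2.ne
    exact ENNReal.add_ne_top.2 ⟨this, this⟩
  · have e : ∫⁻ y, ‖f (y + h)‖ₑ ∂μ = ∫⁻ y, ‖f y‖ₑ ∂μ :=
      lintegral_add_right_eq_self (fun y => ‖f y‖ₑ) h
    calc _ ≤ ∫⁻ y, ‖f (y + h)‖ₑ + ‖f y‖ₑ ∂μ := lintegral_mono fun y => enorm_sub_le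
      _ = _ := by
        rw [lintegral_add_right _ f.continuous.enorm.measurable, e]

theorem SchwartzMap.exists_lintegral_second_difference_le (f : SchwartzMap E F) :
    ∃ B : ℝ≥0∞, B ≠ ⊤ ∧ ∀ h, ∫⁻ y, ‖f (y + h) - (2 : ℝ) • f y + f (y - h)‖ₑ ∂μ ≤
      B * ENNReal.ofReal (min 1 (‖h‖ ^ 2)) := by
  obtain ⟨C, hC⟩ := f.exists_norm_second_difference_le (Module.finrank ℝ E + 1)
  obtain ⟨B, hB, hB'⟩ := f.exists_lintegral_difference_le μ
  refine exists_lintegral_enorm_le_min_one μ (g := fun h y => f (y + h) - (2 : ℝ) • f y + f (y - h))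
    (A := B + B) (ENNReal.add_ne_top.2 ⟨hB, hB⟩) (fun h => ?_) (Nat.lt_succ_self _) hC
  have hB1 : ∀ h, ∫⁻ y, ‖f (y + h) - f y‖ₑ ∂μ ≤ B := fun h =>
    (hB' h).trans (mul_le_of_le_one_right' (by simp))
  calc _ ≤ ∫⁻ y, ‖f (y + h) - f y‖ₑ + ‖f (y + -h) - f y‖ₑ ∂μ := by
        refine lintegral_mono fun y => ?_
        refine le_trans (le_of_eq ?_) (enorm_add_le _ _)
        congr 1
        rw [two_smul, sub_eq_add_neg y h]
        abel
    _ = _ := lintegral_add_left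
        ((f.continuous.comp (continuous_add_const h)).sub f.continuous).enorm.measurable _
    _ ≤ B + B := add_le_add (hB1 h) (hB1 (-h))

end smooth

section upper
variable {n : ℕ}

theorem conv1_enorm_le (K f : Rn1 n → ℂ) (x : Rn1 n) :
    ‖conv1 K f x‖ₑ ≤ ∫⁻ y, ‖K y‖ₑ * ‖f (x - y)‖ₑ := by
  rw [conv1_eq_integral_sub]
  refine (enorm_integral_le_lintegral_enorm _).trans (le_of_eq ?_)
  simp_rw [enorm_mul]

theorem lintegral_enorm_conv1_rpow_le {p : ℝ} (hp : 1 ≤ p) {K f : Rn1 n → ℂ} (hK : Continuous K)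
    (hf : Continuous f) :
    ∫⁻ x, ‖conv1 K f x‖ₑ ^ p ≤ (∫⁻ y, ‖K y‖ₑ) ^ p * ∫⁻ x, ‖f x‖ₑ ^ p := by
  calc _ ≤ ∫⁻ x, (∫⁻ y, ‖K y‖ₑ * ‖f (x - y)‖ₑ) ^ p :=
        lintegral_mono fun x => ENNReal.rpow_le_rpow (conv1_enorm_le K f x) (by linarith)
    _ ≤ (∫⁻ y, ‖K y‖ₑ) ^ (p - 1) * ∫⁻ y, ‖K y‖ₑ * ∫⁻ x, ‖f (x - y)‖ₑ ^ p :=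
        lintegral_rpow_lintegral_mul_le volume volume hp hK.enorm.measurable
          (F := fun y x => ‖f (x - y)‖ₑ)
          (hf.comp (continuous_snd.sub continuous_fst)).enorm.measurable
    _ = _ := by
        simp_rw [lintegral_sub_right_eq_self (fun x => ‖f x‖ₑ ^ p)]
        rw [lintegral_mul_const _ hK.enorm.measurable, ← mul_assoc]
        congr 1
        generalize ∫⁻ y, ‖K y‖ₑ = a
        conv_rhs => rw [show p = (p - 1) + 1 by ring,
          ENNReal.rpow_add_of_nonneg _ _ (by linarith) zero_le_one, ENNReal.rpow_one]

theorem IsNice.comp_add {g : Rn1 n → ℂ} (hg : IsNice g) (h : Rn1 n) :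
    IsNice (fun x => g (x + h)) where
  cont := hg.cont.comp (by fun_prop)
  int := hg.int.comp_add_right h
  bdd := hg.bdd.imp fun M hM x => hM _

theorem conv1_comp_add (K f : Rn1 n → ℂ) (x h : Rn1 n) :
    conv1 K f (x + h) = conv1 (fun z => K (z + h)) f x := by
  simp only [conv1, sub_add_eq_add_sub]

theorem IsNice.integrable_sub_mul {g f : Rn1 n → ℂ} (hg : IsNice g) (hf : IsNice f) (x : Rn1 n) :
    Integrable fun y => g (x - y) * f y := by
  simpa using (hg.integrable_mul_sub hf x).comp_sub_left x

theorem conv1_add_left {K L f : Rn1 n → ℂ} (hK : IsNice K) (hL : IsNice L) (hf : IsNice f)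
    (x : Rn1 n) :
    conv1 (fun z => K z + L z) f x = conv1 K f x + conv1 L f x := by
  simp only [conv1, add_mul]
  exact integral_add (hK.integrable_sub_mul hf x) (hL.integrable_sub_mul hf x)

theorem conv1_sub_left {K L f : Rn1 n → ℂ} (hK : IsNice K) (hL : IsNice L) (hf : IsNice f)
    (x : Rn1 n) :
    conv1 (fun z => K z - L z) f x = conv1 K f x - conv1 L f x := by
  simp only [conv1, sub_mul]
  exact integral_sub (hK.integrable_sub_mul hf x) (hL.integrable_sub_mul hf x)

theorem conv1_sub_right {K f g : Rn1 n → ℂ} (hK : IsNice K) (hf : IsNice f) (hg : IsNice g)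
    (x : Rn1 n) :
    conv1 K (fun z => f z - g z) x = conv1 K f x - conv1 K g x := by
  simp only [conv1, mul_sub]
  exact integral_sub (hK.integrable_sub_mul hf x) (hK.integrable_sub_mul hg x)

theorem conv1_const_mul_left (K f : Rn1 n → ℂ) (c : ℂ) (x : Rn1 n) :
    conv1 (fun z => c * K z) f x = c * conv1 K f x := by
  simp only [conv1, mul_assoc]
  exact integral_const_mul _ _

theorem exists_schwartzMap_eq_pscale (f : SchwartzMap (Rn1 n) ℂ) {r : ℝ} (hr : 0 < r) :
    ∃ g : SchwartzMap (Rn1 n) ℂ, (g : Rn1 n → ℂ) = pscale r f :=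
  ⟨((r ^ (n + 2) : ℝ) : ℂ) • SchwartzMap.compCLMOfContinuousLinearEquiv ℂ
    (((LinearEquiv.smulOfNeZero ℝ (Rn n) r hr.ne').prodCongr
      (LinearEquiv.smulOfNeZero ℝ ℝ (r ^ 2) (pow_pos hr 2).ne')).toContinuousLinearEquiv) f, rfl⟩

theorem lintegral_conv1_add_sub_rpow_le {p : ℝ} (hp : 1 ≤ p) {K f : Rn1 n → ℂ} (hK : IsNice K)
    (hf : IsNice f) (h : Rn1 n) :
    ∫⁻ x, ‖conv1 K f (x + h) - conv1 K f x‖ₑ ^ p ≤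
      (∫⁻ y, ‖K (y + h) - K y‖ₑ) ^ p * ∫⁻ x, ‖f x‖ₑ ^ p := by
  have hKh := hK.comp_add h
  simp_rw [conv1_comp_add, ← conv1_sub_left hKh hK hf]
  exact lintegral_enorm_conv1_rpow_le hp (hKh.sub hK).cont hf.cont

theorem lintegral_conv1_second_difference_rpow_le {p : ℝ} (hp : 1 ≤ p) {K f : Rn1 n → ℂ}
    (hK : IsNice K) (hf : IsNice f) (h : Rn1 n) :
    ∫⁻ x, ‖conv1 K f (x + h) - 2 * conv1 K f x + conv1 K f (x - h)‖ₑ ^ p ≤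
      (∫⁻ y, ‖K (y + h) - 2 * K y + K (y - h)‖ₑ) ^ p * ∫⁻ x, ‖f x‖ₑ ^ p := by
  have h1 := hK.comp_add h
  have h2 := hK.comp_add (-h)
  have h3 := hK.const_mul 2
  simp_rw [sub_eq_add_neg _ h]
  simp_rw [conv1_comp_add, ← conv1_const_mul_left, ← conv1_sub_left h1 h3 hf,
    ← conv1_add_left (h1.sub h3) h2 hf]
  exact lintegral_enorm_conv1_rpow_le hp ((h1.sub h3).add h2).cont hf.cont

theorem lintegral_add_sub_comp_pdil (p : ℝ) {r : ℝ} (hr : 0 < r) (g : Rn1 n → ℂ) (h : Rn1 n) :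
    ∫⁻ x, ‖g (pdil r (x + h)) - g (pdil r x)‖ₑ ^ p = ENNReal.ofReal (r ^ (n + 2))⁻¹ *
      ∫⁻ x, ‖g (x + pdil r h) - g x‖ₑ ^ p := by
  simp_rw [pdil_add]
  exact lintegral_comp_pdil (fun x => ‖g (x + pdil r h) - g x‖ₑ ^ p) hr

theorem lintegral_second_difference_comp_pdil (p : ℝ) {r : ℝ} (hr : 0 < r) (g : Rn1 n → ℂ)
    (h : Rn1 n) :
    ∫⁻ x, ‖g (pdil r (x + h)) - 2 * g (pdil r x) + g (pdil r (x - h))‖ₑ ^ p =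
      ENNReal.ofReal (r ^ (n + 2))⁻¹ *
      ∫⁻ x, ‖g (x + pdil r h) - 2 * g x + g (x - pdil r h)‖ₑ ^ p := by
  simp_rw [pdil_add, pdil_sub]
  exact lintegral_comp_pdil (fun x => ‖g (x + pdil r h) - 2 * g x + g (x - pdil r h)‖ₑ ^ p) hr

/-- Bernstein-type bounds for the first and second differences of a frequency-localised piece. -/
theorem ParabolicLP.exists_difference_bounds (P : ParabolicLP n) {p : ℝ} (hp : 1 ≤ p) :
    ∃ C : ℝ≥0∞, C ≠ ⊤ ∧ ∀ (K f : Rn1 n → ℂ) (r : ℝ), 0 < r → IsNice K → IsNice f →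
      (∀ q, 2 ≤ psz q → FT1 K q = 0) → ∀ h : Rn1 n,
      (∫⁻ x, ‖conv1 (pscale r K) f (x + h) - conv1 (pscale r K) f x‖ₑ ^ p ≤
        C * ENNReal.ofReal (min 1 (‖pdil r h‖ ^ 1)) ^ p * ∫⁻ x, ‖conv1 (pscale r K) f x‖ₑ ^ p) ∧
      (∫⁻ x, ‖conv1 (pscale r K) f (x + h) - 2 * conv1 (pscale r K) f x +
          conv1 (pscale r K) f (x - h)‖ₑ ^ p ≤
        C * ENNReal.ofReal (min 1 (‖pdil r h‖ ^ 2)) ^ p *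
          ∫⁻ x, ‖conv1 (pscale r K) f x‖ₑ ^ p) := by
  obtain ⟨Φ, hΦ⟩ := exists_schwartzMap_eq_pscale P.ψ two_pos
  obtain ⟨A, hA, hA'⟩ := Φ.exists_lintegral_difference_le (volume : Measure (Rn1 n))
  obtain ⟨B, hB, hB'⟩ := Φ.exists_lintegral_second_difference_le (volume : Measure (Rn1 n))
  have hp0 : 0 ≤ p := by linarith
  refine ⟨A ^ p + B ^ p, ENNReal.add_ne_top.2 ⟨ENNReal.rpow_ne_top_of_nonneg hp0 hA,
    ENNReal.rpow_ne_top_of_nonneg hp0 hB⟩, fun K f r hr hK hf hsupp h => ?_⟩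
  have hf' := hf.comp_pdil (inv_pos.2 hr)
  have hG := hK.conv1 hf'
  set G := conv1 K fun y => f (pdil r⁻¹ y) with hGdef
  have hGG : conv1 Φ G = G := by rw [hΦ]; exact P.conv1_pscale_two_psi hK hf' hsupp
  have e : ∀ x, conv1 (pscale r K) f x = G (pdil r x) := conv1_pscale K f hr
  simp_rw [e]
  rw [lintegral_add_sub_comp_pdil p hr, lintegral_second_difference_comp_pdil p hr,
    lintegral_comp_pdil (fun x => ‖G x‖ₑ ^ p) hr]
  have h1 := lintegral_conv1_add_sub_rpow_le hp Φ.isNice hG (pdil r h)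
  have h2 := lintegral_conv1_second_difference_rpow_le hp Φ.isNice hG (pdil r h)
  rw [hGG] at h1 h2
  have hB'' := hB' (pdil r h)
  simp only [Complex.real_smul, Complex.ofReal_ofNat] at hB''
  constructor
  · rw [mul_left_comm]
    gcongr
    refine h1.trans ?_
    gcongr
    refine (ENNReal.rpow_le_rpow (hA' _) hp0).trans ?_
    rw [ENNReal.mul_rpow_of_nonneg _ _ hp0]
    gcongr
    exact le_self_add
  · rw [mul_left_comm]
    gcongr
    refine h2.trans ?_
    gcongr
    refine (ENNReal.rpow_le_rpow hB'' hp0).trans ?_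
    rw [ENNReal.mul_rpow_of_nonneg _ _ hp0]
    gcongr
    exact le_add_self

end upper

section lower
variable {n : ℕ}

/-- The `p`-th power of the `Lᵖ` norm of the first difference of `g` in time with step `t`. -/
def timeDiff (p : ℝ) (g : Rn1 n → ℂ) (t : ℝ) : ℝ≥0∞ :=
  ∫⁻ x, ‖g (x + (0, t)) - g x‖ₑ ^ p

/-- The `p`-th power of the `Lᵖ` norm of the second difference of `g` in space with step `Y`. -/
def spaceDiff (p : ℝ) (g : Rn1 n → ℂ) (Y : Rn n) : ℝ≥0∞ :=
  ∫⁻ x, ‖g (x + (Y, 0)) - 2 * g x + g (x - (Y, 0))‖ₑ ^ p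

theorem measurable_timeDiff (p : ℝ) {g : Rn1 n → ℂ} (hg : Continuous g) :
    Measurable (timeDiff p g) := by
  have : Measurable fun z : ℝ × Rn1 n => ‖g (z.2 + (0, z.1)) - g z.2‖ₑ ^ p :=
    (Continuous.enorm (by fun_prop)).measurable.pow_const p
  exact this.lintegral_prod_right'

theorem measurable_spaceDiff (p : ℝ) {g : Rn1 n → ℂ} (hg : Continuous g) :
    Measurable (spaceDiff p g) := by
  have : Measurable fun z : Rn n × Rn1 n =>
      ‖g (z.2 + (z.1, 0)) - 2 * g z.2 + g (z.2 - (z.1, 0))‖ₑ ^ p :=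
    (Continuous.enorm (by fun_prop)).measurable.pow_const p
  exact this.lintegral_prod_right'

theorem two_mul_sub_conv1 {K g : Rn1 n → ℂ} (hK : IsNice K) (hKn : ∀ Y t, K (-Y, t) = K (Y, t))
    (hK1 : ∫ y, K y = 1) (hg : IsNice g) (x : Rn1 n) :
    2 * (g x - conv1 K g x) = ∫ y, K y * (2 * (g x - g (x - (0, y.2))) -
      (g (x - (0, y.2) + (y.1, 0)) - 2 * g (x - (0, y.2)) + g (x - (0, y.2) - (y.1, 0)))) := by
  have h1 : conv1 K g x = ∫ y, K y * g (x - (0, y.2) - (y.1, 0)) := by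
    rw [conv1_eq_integral_sub]
    congr 1
    ext y
    congr 2
    ext <;> simp
  have hi1 : Integrable fun y : Rn1 n => K y * g (x - (0, y.2) - (y.1, 0)) := by
    refine (hK.integrable_mul_sub hg x).congr (Filter.Eventually.of_forall fun y => ?_)
    dsimp only
    congr 2
    ext <;> simp
  have e : ∀ y : Rn1 n, K (-y.1, y.2) * g (x - (0, y.2) - (-y.1, 0)) =
      K y * g (x - (0, y.2) + (y.1, 0)) := fun y => by
    rw [hKn]
    congr 2
    ext <;> simp
  have h2 : conv1 K g x = ∫ y, K y * g (x - (0, y.2) + (y.1, 0)) := by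
    rw [h1, ← measurePreserving_xneg.integral_comp measurableEmbedding_xneg]
    exact integral_congr_ae (Filter.Eventually.of_forall e)
  have hi2 : Integrable fun y : Rn1 n => K y * g (x - (0, y.2) + (y.1, 0)) :=
    (measurePreserving_xneg.integrable_comp_of_integrable hi1).congr
      (Filter.Eventually.of_forall e)
  have h0 : ∫ y, K y * (2 * g x) = 2 * g x := by rw [integral_mul_const, hK1, one_mul]
  have hi0 : Integrable fun y : Rn1 n => K y * (2 * g x) := hK.int.mul_const _
  calc 2 * (g x - conv1 K g x) = 2 * g x - conv1 K g x - conv1 K g x := by ring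
    _ = ∫ y, (K y * (2 * g x) - K y * g (x - (0, y.2) + (y.1, 0)) -
        K y * g (x - (0, y.2) - (y.1, 0))) := by
      have hi3 : Integrable fun y : Rn1 n =>
        K y * (2 * g x) - K y * g (x - (0, y.2) + (y.1, 0)) := hi0.sub hi2
      rw [integral_sub hi3 hi1, integral_sub hi0 hi2, h0, ← h1, ← h2]
    _ = _ := by congr 1; ext y; ring

theorem lintegral_sub_conv1_rpow_le {p : ℝ} (hp : 1 ≤ p) {K g : Rn1 n → ℂ} (hK : IsNice K)
    (hKn : ∀ Y t, K (-Y, t) = K (Y, t)) (hK1 : ∫ y, K y = 1) (hg : IsNice g) :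
    ∫⁻ x, ‖g x - conv1 K g x‖ₑ ^ p ≤ (∫⁻ y, ‖K y‖ₑ) ^ (p - 1) *
      ∫⁻ y, ‖K y‖ₑ * (2 ^ (p - 1) * (2 ^ p * timeDiff p g y.2 + spaceDiff p g y.1)) := by
  have hp0 : 0 ≤ p := by linarith
  have hgc := hg.cont
  have hb : ∀ x, ‖g x - conv1 K g x‖ₑ ≤ ∫⁻ y, ‖K y‖ₑ * (2 * ‖g x - g (x - (0, y.2))‖ₑ +
      ‖g (x - (0, y.2) + (y.1, 0)) - 2 * g (x - (0, y.2)) + g (x - (0, y.2) - (y.1, 0))‖ₑ) := by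
    intro x
    have h2 : ‖(2 : ℂ)‖ₑ = 2 := by
      rw [← ofReal_norm]; norm_num
    calc ‖g x - conv1 K g x‖ₑ ≤ 2 * ‖g x - conv1 K g x‖ₑ := le_mul_of_one_le_left' one_le_two
      _ = ‖2 * (g x - conv1 K g x)‖ₑ := by rw [enorm_mul, h2]
      _ ≤ _ := by
        rw [two_mul_sub_conv1 hK hKn hK1 hg]
        refine (enorm_integral_le_lintegral_enorm _).trans (lintegral_mono fun y => ?_)
        rw [enorm_mul]
        gcongr
        refine enorm_sub_le.trans ?_
        rw [enorm_mul, h2]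
  calc _ ≤ ∫⁻ x, (∫⁻ y, ‖K y‖ₑ * (2 * ‖g x - g (x - (0, y.2))‖ₑ +
      ‖g (x - (0, y.2) + (y.1, 0)) - 2 * g (x - (0, y.2)) + g (x - (0, y.2) - (y.1, 0))‖ₑ)) ^ p :=
        lintegral_mono fun x => ENNReal.rpow_le_rpow (hb x) hp0
    _ ≤ _ := lintegral_rpow_lintegral_mul_le volume volume hp hK.cont.enorm.measurable
          (F := fun y x => 2 * ‖g x - g (x - (0, y.2))‖ₑ +
      ‖g (x - (0, y.2) + (y.1, 0)) - 2 * g (x - (0, y.2)) + g (x - (0, y.2) - (y.1, 0))‖ₑ) (by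
          have c1 : Measurable fun z : Rn1 n × Rn1 n => ‖g z.2 - g (z.2 - (0, z.1.2))‖ₑ :=
            (Continuous.enorm (by fun_prop)).measurable
          have c2 : Measurable fun z : Rn1 n × Rn1 n => ‖g (z.2 - (0, z.1.2) + (z.1.1, 0)) -
              2 * g (z.2 - (0, z.1.2)) + g (z.2 - (0, z.1.2) - (z.1.1, 0))‖ₑ :=
            (Continuous.enorm (by fun_prop)).measurable
          exact (c1.const_mul 2).add c2)
    _ ≤ _ := by
        gcongr with y
        set S : Rn1 n → ℂ := fun x => g (x + (y.1, 0)) - 2 * g x + g (x - (y.1, 0))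
        have m1 : Measurable fun x => ‖g x - g (x - (0, y.2))‖ₑ ^ p :=
          (Continuous.enorm (by fun_prop)).measurable.pow_const p
        calc _ ≤ ∫⁻ x, 2 ^ (p - 1) * (2 ^ p * ‖g x - g (x - (0, y.2))‖ₑ ^ p +
              ‖S (x - (0, y.2))‖ₑ ^ p) := by
              refine lintegral_mono fun x => ?_
              rw [← ENNReal.mul_rpow_of_nonneg _ _ hp0]
              exact ENNReal.rpow_add_le_mul_rpow_add_rpow _ _ hp
          _ = 2 ^ (p - 1) * (2 ^ p * (∫⁻ x : Rn1 n, ‖g x - g (x - (0, y.2))‖ₑ ^ p) +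
              ∫⁻ x : Rn1 n, ‖S (x - (0, y.2))‖ₑ ^ p) := by
              rw [lintegral_const_mul' _ _ (ENNReal.rpow_ne_top_of_nonneg (by linarith) (by simp)),
                lintegral_add_left (m1.const_mul _), lintegral_const_mul _ m1]
          _ = _ := by
              rw [lintegral_sub_right_eq_self (fun x => ‖S x‖ₑ ^ p),
                ← lintegral_add_right_eq_self (fun x : Rn1 n => ‖g x - g (x - (0, y.2))‖ₑ ^ p)
                  (0, y.2)]
              simp only [add_sub_cancel_right]
              rfl

theorem SchwartzMap.exists_norm_le_mul_rpow (f : SchwartzMap (Rn1 n) ℂ) (m : ℕ) :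
    ∃ C : ℝ, 0 ≤ C ∧ ∀ y, ‖f y‖ ≤ C * ((1 + ‖y.1‖) ^ (-(m : ℝ)) * (1 + ‖y.2‖) ^ (-(m : ℝ))) := by
  obtain ⟨C, hC⟩ := f.exists_norm_le (m + m)
  have hC0 : 0 ≤ C := by simpa using (norm_nonneg _).trans (hC 0)
  refine ⟨C, hC0, fun y => (hC y).trans ?_⟩
  simp only [Real.rpow_neg (add_nonneg zero_le_one (norm_nonneg _)), Real.rpow_natCast]
  rw [pow_add, mul_inv]
  gcongr
  · exact norm_fst_le y
  · exact norm_snd_le y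

theorem ParabolicLP.exists_enorm_evenKer_le (P : ParabolicLP n) (m : ℕ) :
    ∃ C : ℝ≥0∞, C ≠ ⊤ ∧ ∀ y, ‖P.evenKer y‖ₑ ≤ C * (ENNReal.ofReal ((1 + ‖y.1‖) ^ (-(m : ℝ))) *
      ENNReal.ofReal ((1 + ‖y.2‖) ^ (-(m : ℝ)))) := by
  obtain ⟨Φ, hΦ⟩ := exists_schwartzMap_eq_pscale P.ψ (r := 4⁻¹) (by norm_num)
  obtain ⟨C, hC0, hC⟩ := Φ.exists_norm_le_mul_rpow m
  refine ⟨ENNReal.ofReal C, ENNReal.ofReal_ne_top, fun y => ?_⟩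
  rw [← ENNReal.ofReal_mul (by positivity), ← ENNReal.ofReal_mul hC0, ← ofReal_norm]
  refine ENNReal.ofReal_le_ofReal ?_
  have h2 := hC (-y.1, y.2)
  rw [norm_neg] at h2
  rw [ParabolicLP.evenKer, ← hΦ, xrefl, norm_mul]
  calc _ ≤ ‖(1 / 2 : ℂ)‖ * (‖Φ y‖ + ‖Φ (-y.1, y.2)‖) := by gcongr; exact norm_add_le _ _
    _ ≤ (1 / 2) * (C * ((1 + ‖y.1‖) ^ (-(m : ℝ)) * (1 + ‖y.2‖) ^ (-(m : ℝ))) +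
        C * ((1 + ‖y.1‖) ^ (-(m : ℝ)) * (1 + ‖y.2‖) ^ (-(m : ℝ)))) := by
      gcongr
      · norm_num
      · exact hC y
    _ = _ := by ring

theorem timeDiff_comp_pdil (p : ℝ) (g : Rn1 n → ℂ) {r : ℝ} (hr : 0 < r) (t : ℝ) :
    timeDiff p (fun x => g (pdil r x)) t =
      ENNReal.ofReal (r ^ (n + 2))⁻¹ * timeDiff p g (r ^ 2 * t) := by
  rw [timeDiff, lintegral_add_sub_comp_pdil p hr g (0, t)]
  simp [timeDiff, pdil]

theorem spaceDiff_comp_pdil (p : ℝ) (g : Rn1 n → ℂ) {r : ℝ} (hr : 0 < r) (Y : Rn n) :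
    spaceDiff p (fun x => g (pdil r x)) Y =
      ENNReal.ofReal (r ^ (n + 2))⁻¹ * spaceDiff p g (r • Y) := by
  rw [spaceDiff, lintegral_second_difference_comp_pdil p hr g (Y, 0)]
  simp [spaceDiff, pdil]

theorem ParabolicLP.exists_conv1_phi_le (P : ParabolicLP n) {p : ℝ} (hp : 1 ≤ p) {m : ℕ}
    (hm : n + 1 < m) :
    ∃ C : ℝ≥0∞, C ≠ ⊤ ∧ ∀ g : Rn1 n → ℂ, IsNice g →
      ∫⁻ x, ‖conv1 P.φ g x‖ₑ ^ p ≤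
        C * ((∫⁻ t : ℝ, ENNReal.ofReal ((1 + ‖t‖) ^ (-(m : ℝ))) * timeDiff p g t) +
          ∫⁻ Y : Rn n, ENNReal.ofReal ((1 + ‖Y‖) ^ (-(m : ℝ))) * spaceDiff p g Y) := by
  have hp0 : 0 ≤ p := by linarith
  obtain ⟨A, hA, hA'⟩ := P.exists_enorm_evenKer_le m
  set κt : ℝ → ℝ≥0∞ := fun t => ENNReal.ofReal ((1 + ‖t‖) ^ (-(m : ℝ)))
  set κx : Rn n → ℝ≥0∞ := fun Y => ENNReal.ofReal ((1 + ‖Y‖) ^ (-(m : ℝ)))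
  have hκt : ∫⁻ t, κt t ≠ ⊤ := (finite_integral_one_add_norm (μ := (volume : Measure ℝ))
    (r := (m : ℝ)) (by simp; omega)).ne
  have hκx : ∫⁻ Y, κx Y ≠ ⊤ := (finite_integral_one_add_norm (μ := (volume : Measure (Rn n)))
    (r := (m : ℝ)) (by simp; omega)).ne
  have mκt : Measurable κt := by fun_prop
  have mκx : Measurable κx := by fun_prop
  set k := ∫⁻ y, ‖P.evenKer y‖ₑ
  have hk : k ≠ ⊤ := P.isNice_evenKer.int.2.ne
  set L := ∫⁻ y, ‖P.φ y‖ₑ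
  have hL : L ≠ ⊤ := P.φ.isNice.int.2.ne
  refine ⟨L ^ p * k ^ (p - 1) * A * 2 ^ (p - 1) * (2 ^ p * (∫⁻ Y, κx Y) + ∫⁻ t, κt t), ?_,
    fun g hg => ?_⟩
  · have h2 : ∀ {a : ℝ}, 0 ≤ a → (2 : ℝ≥0∞) ^ a ≠ ⊤ := fun ha =>
      ENNReal.rpow_ne_top_of_nonneg ha (by simp)
    exact ENNReal.mul_ne_top (ENNReal.mul_ne_top (ENNReal.mul_ne_top (ENNReal.mul_ne_top
      (ENNReal.rpow_ne_top_of_nonneg hp0 hL) (ENNReal.rpow_ne_top_of_nonneg (by linarith) hk)) hA)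
      (h2 (by linarith))) (ENNReal.add_ne_top.2 ⟨ENNReal.mul_ne_top (h2 hp0) hκx, hκt⟩)
  have mT := measurable_timeDiff p hg.cont
  have mX := measurable_spaceDiff p hg.cont
  have hgK := P.isNice_evenKer.conv1 hg
  have e : ∀ x, conv1 P.φ g x = conv1 P.φ (fun z => g z - conv1 P.evenKer g z) x := fun x => by
    rw [conv1_sub_right P.φ.isNice hg hgK, P.conv1_phi_evenKer hg]
    simp
  simp_rw [e]
  have hprod : ∫⁻ y : Rn1 n, κx y.1 * κt y.2 * (2 ^ p * timeDiff p g y.2 + spaceDiff p g y.1) =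
      2 ^ p * ((∫⁻ Y, κx Y) * ∫⁻ t, κt t * timeDiff p g t) +
        (∫⁻ Y, κx Y * spaceDiff p g Y) * ∫⁻ t, κt t := by
    have m1 : Measurable fun t => κt t * timeDiff p g t := mκt.mul mT
    have m2 : Measurable fun Y => κx Y * spaceDiff p g Y := mκx.mul mX
    have m3 : Measurable fun y : Rn1 n => κx y.1 * (κt y.2 * timeDiff p g y.2) :=
      (mκx.comp measurable_fst).mul (m1.comp measurable_snd)
    have m4 : Measurable fun y : Rn1 n => κx y.1 * spaceDiff p g y.1 * κt y.2 :=
      (m2.comp measurable_fst).mul (mκt.comp measurable_snd)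
    rw [← lintegral_prod_mul mκx.aemeasurable m1.aemeasurable,
      ← lintegral_prod_mul m2.aemeasurable mκt.aemeasurable, ← lintegral_const_mul _ m3,
      ← lintegral_add_right _ m4]
    refine lintegral_congr fun y => ?_
    ring
  calc _ ≤ L ^ p * ∫⁻ x, ‖g x - conv1 P.evenKer g x‖ₑ ^ p :=
        lintegral_enorm_conv1_rpow_le hp P.φ.continuous (hg.sub hgK).cont
    _ ≤ L ^ p * (k ^ (p - 1) * ∫⁻ y, ‖P.evenKer y‖ₑ *
          (2 ^ (p - 1) * (2 ^ p * timeDiff p g y.2 + spaceDiff p g y.1))) := by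
        gcongr
        exact lintegral_sub_conv1_rpow_le hp P.isNice_evenKer P.evenKer_neg P.integral_evenKer hg
    _ ≤ L ^ p * (k ^ (p - 1) * ∫⁻ y : Rn1 n, A * (2 ^ (p - 1) * (κx y.1 * κt y.2 *
          (2 ^ p * timeDiff p g y.2 + spaceDiff p g y.1)))) := by
        gcongr L ^ p * (k ^ (p - 1) * ?_)
        refine lintegral_mono fun y => (mul_le_mul_left (hA' y) _).trans (le_of_eq ?_)
        ring
    _ = L ^ p * k ^ (p - 1) * A * 2 ^ (p - 1) *
      (2 ^ p * ((∫⁻ Y, κx Y) * ∫⁻ t, κt t * timeDiff p g t) +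
        (∫⁻ Y, κx Y * spaceDiff p g Y) * ∫⁻ t, κt t) := by
        rw [lintegral_const_mul' _ _ hA, lintegral_const_mul' _ _
          (ENNReal.rpow_ne_top_of_nonneg (by linarith) (by simp)), hprod]
        ring
    _ ≤ _ := by
        rw [mul_assoc _ (_ + _)]
        gcongr
        rw [add_mul, mul_add, mul_add, ← mul_assoc, mul_comm (∫⁻ Y, κx Y * spaceDiff p g Y)]
        exact add_le_add le_self_add le_add_self

theorem ParabolicLP.exists_conv1_pscale_phi_le (P : ParabolicLP n) {p : ℝ} (hp : 1 ≤ p) {m : ℕ}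
    (hm : n + 1 < m) :
    ∃ C : ℝ≥0∞, C ≠ ⊤ ∧ ∀ (g : Rn1 n → ℂ) (r : ℝ), 0 < r → IsNice g →
      ∫⁻ x, ‖conv1 (pscale r P.φ) g x‖ₑ ^ p ≤
        C * ((∫⁻ t : ℝ, ENNReal.ofReal ((1 + ‖t‖) ^ (-(m : ℝ))) * timeDiff p g ((r ^ 2)⁻¹ * t)) +
          ∫⁻ Y : Rn n, ENNReal.ofReal ((1 + ‖Y‖) ^ (-(m : ℝ))) * spaceDiff p g (r⁻¹ • Y)) := by
  obtain ⟨C, hC, hC'⟩ := P.exists_conv1_phi_le hp hm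
  refine ⟨C, hC, fun g r hr hg => ?_⟩
  have hr' := inv_pos.2 hr
  simp_rw [conv1_pscale _ _ hr]
  rw [lintegral_comp_pdil (fun x => ‖conv1 P.φ (fun y => g (pdil r⁻¹ y)) x‖ₑ ^ p) hr]
  refine (mul_le_mul_right (hC' _ (hg.comp_pdil hr')) _).trans (le_of_eq ?_)
  simp_rw [timeDiff_comp_pdil p g hr', spaceDiff_comp_pdil p g hr',
    mul_left_comm _ (ENNReal.ofReal (r⁻¹ ^ (n + 2))⁻¹)]
  rw [lintegral_const_mul' _ _ ENNReal.ofReal_ne_top,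
    lintegral_const_mul' _ _ ENNReal.ofReal_ne_top,
    ← mul_add, mul_left_comm C, ← mul_assoc, ← ENNReal.ofReal_mul (by positivity), inv_pow, inv_inv,
    inv_mul_cancel₀ (by positivity), ENNReal.ofReal_one, one_mul]
  simp_rw [inv_pow]

end lower

section telescoping
variable {n : ℕ}
open Filter Topology

theorem tendsto_conv1_pscale {K f : Rn1 n → ℂ} (hK : IsNice K) (hK1 : ∫ y, K y = 1) (hf : IsNice f)
    (x : Rn1 n) :
    Tendsto (fun N : ℕ => conv1 (pscale (2 ^ N) K) f x) atTop (𝓝 (f x)) := by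
  have e : ∀ N : ℕ, conv1 (pscale (2 ^ N) K) f x =
    ∫ y, K y * f (x - pdil (2 ^ N)⁻¹ y) := fun N => by
    rw [conv1_pscale K f (by positivity), conv1_eq_integral_sub]
    simp_rw [pdil_sub, pdil_pdil]
    rw [inv_mul_cancel₀ (by positivity), pdil_one]
  simp_rw [e]
  have h0 : ∫ y, K y * f x = f x := by rw [integral_mul_const, hK1, one_mul]
  obtain ⟨M, hM⟩ := hf.bdd
  conv => congr; · skip
          · skip
          · rw [← h0]
  have hfc := hf.cont
  have hKc := hK.cont
  refine tendsto_integral_of_dominated_convergence (fun y => ‖K y‖ * M) (fun _ => ?_)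
    (hK.int.norm.mul_const M) (fun _ => Eventually.of_forall fun y => ?_)
    (Eventually.of_forall fun y => ?_)
  · have := continuous_pdil (n := n)
    exact (hKc.mul (hfc.comp (continuous_const.sub (this _)))).aestronglyMeasurable
  · rw [norm_mul]
    gcongr
    exact hM _
  · refine Tendsto.const_mul _ ((hfc.tendsto' _ _ rfl).comp ?_)
    have h1 : Tendsto (fun N : ℕ => ((2 : ℝ) ^ N)⁻¹) atTop (𝓝 0) := by
      simpa using tendsto_pow_atTop_nhds_zero_of_lt_one (r := (2 : ℝ)⁻¹) (by norm_num) (by norm_num)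
    have h2 : Tendsto (fun s : ℝ => x - pdil s y) (𝓝 0) (𝓝 x) := by
      refine Continuous.tendsto' ?_ _ _ (by simp [pdil])
      unfold pdil
      fun_prop
    exact h2.comp h1

theorem enorm_le_tsum_of_tendsto {a : ℂ} {F : ℕ → ℂ}
    (h : Tendsto (fun N => ∑ i ∈ Finset.range N, F i) atTop (𝓝 a)) : ‖a‖ₑ ≤ ∑' i, ‖F i‖ₑ :=
  le_of_tendsto h.enorm (Eventually.of_forall fun _ =>
    (enorm_sum_le _ _).trans (ENNReal.sum_le_tsum _))

namespace ParabolicLP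
variable (P : ParabolicLP n)

/-- The unscaled kernels `ψ, φ, φ, …` of the Littlewood–Paley pieces. -/
def ker : ℕ → Rn1 n → ℂ
  | 0 => P.ψ
  | _ + 1 => P.φ

/-- The Littlewood–Paley pieces `ψ * f, φ₁ * f, φ₂ * f, …`. -/
def piece (f : Rn1 n → ℂ) (i : ℕ) : Rn1 n → ℂ :=
  conv1 (pscale (2 ^ i) (P.ker i)) f

theorem isNice_ker : ∀ i, IsNice (P.ker i)
  | 0 => P.ψ.isNice
  | _ + 1 => P.φ.isNice

theorem FT1_ker_of_ge {q : Rn1 n} (hq : 2 ≤ psz q) : ∀ i, FT1 (P.ker i) q = 0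
  | 0 => P.FT1_psi_of_ge hq
  | _ + 1 => P.FT1_phi_eq_zero_of_ge hq

theorem piece_zero (f : Rn1 n → ℂ) : P.piece f 0 = conv1 P.ψ f := by
  have : pscale (2 ^ 0) (P.ker 0) = P.ψ := by
    ext x
    simp [pscale, ker, pdil_one]
  rw [piece, this]

theorem piece_succ (f : Rn1 n → ℂ) (i : ℕ) : P.piece f (i + 1) = conv1 (lpPhi P (i + 1)) f := by
  rw [piece, ker, P.lpPhi_eq]

variable {f : Rn1 n → ℂ}

theorem isNice_piece (hf : IsNice f) (i : ℕ) : IsNice (P.piece f i) :=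
  ((P.isNice_ker i).pscale (by positivity)).conv1 hf

theorem sum_piece (hf : IsNice f) (x : Rn1 n) (N : ℕ) :
    ∑ i ∈ Finset.range (N + 1), P.piece f i x = conv1 (pscale (2 ^ N) P.ψ) f x := by
  induction N with
  | zero => simp [piece, ker]
  | succ N ih =>
    have e : lpPhi P (N + 1) = fun z => pscale (2 ^ (N + 1)) P.ψ z - pscale (2 ^ N) P.ψ z :=
      funext fun z => P.lpPhi_succ N z
    rw [Finset.sum_range_succ, ih, piece_succ, e,
      conv1_sub_left (P.ψ.isNice.pscale (by positivity)) (P.ψ.isNice.pscale (by positivity)) hf]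
    ring

theorem tendsto_sum_piece (hf : IsNice f) (x : Rn1 n) :
    Tendsto (fun N => ∑ i ∈ Finset.range N, P.piece f i x) atTop (𝓝 (f x)) := by
  rw [← tendsto_add_atTop_iff_nat 1]
  simp_rw [P.sum_piece hf]
  exact tendsto_conv1_pscale P.ψ.isNice P.integral_psi hf x

theorem enorm_le_tsum_piece (hf : IsNice f) (x : Rn1 n) : ‖f x‖ₑ ≤ ∑' i, ‖P.piece f i x‖ₑ :=
  enorm_le_tsum_of_tendsto (P.tendsto_sum_piece hf x)

theorem enorm_difference_le_tsum_piece (hf : IsNice f) (x h : Rn1 n) :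
    ‖f (x + h) - f x‖ₑ ≤ ∑' i, ‖P.piece f i (x + h) - P.piece f i x‖ₑ := by
  refine enorm_le_tsum_of_tendsto ?_
  simp_rw [Finset.sum_sub_distrib]
  exact (P.tendsto_sum_piece hf _).sub (P.tendsto_sum_piece hf _)

theorem enorm_second_difference_le_tsum_piece (hf : IsNice f) (x h : Rn1 n) :
    ‖f (x + h) - 2 * f x + f (x - h)‖ₑ ≤
      ∑' i, ‖P.piece f i (x + h) - 2 * P.piece f i x + P.piece f i (x - h)‖ₑ := by
  refine enorm_le_tsum_of_tendsto ?_
  simp_rw [Finset.sum_add_distrib, Finset.sum_sub_distrib, ← Finset.mul_sum]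
  exact ((P.tendsto_sum_piece hf _).sub ((P.tendsto_sum_piece hf _).const_mul 2)).add
    (P.tendsto_sum_piece hf _)

end ParabolicLP
end telescoping

section energy
variable {n : ℕ}

/-- The weighted integral of the first differences in time. -/
def timeEnergy (α p : ℝ) (f : Rn1 n → ℂ) : ℝ≥0∞ :=
  ∫⁻ t : ℝ, ENNReal.ofReal (‖t‖ ^ (-(1 + p * (α / 2)))) * timeDiff p f t

/-- The weighted integral of the second differences in space. -/
def spaceEnergy (α p : ℝ) (f : Rn1 n → ℂ) : ℝ≥0∞ :=
  ∫⁻ Y : Rn n, ENNReal.ofReal (‖Y‖ ^ (-((n : ℝ) + p * α))) * spaceDiff p f Y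

theorem four_pow_rpow (i : ℕ) (a p : ℝ) : (((4 : ℝ) ^ i) ^ (a / 2 * p)) =
    ((2 : ℝ) ^ i) ^ (a * p) := by
  rw [show (4 : ℝ) = 2 ^ 2 by norm_num, ← pow_mul, mul_comm 2 i, pow_mul, ← Real.rpow_natCast _ 2,
    ← Real.rpow_mul (by positivity)]
  congr 1
  push_cast
  ring

namespace ParabolicLP
variable (P : ParabolicLP n)

/-- The weighted `ℓᵖ(Lᵖ)` sum of the Littlewood–Paley pieces. -/
def energy (α p : ℝ) (f : Rn1 n → ℂ) : ℝ≥0∞ :=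
  ∑' i : ℕ, ENNReal.ofReal (((2 : ℝ) ^ i) ^ (α * p)) * ∫⁻ x, ‖P.piece f i x‖ₑ ^ p

theorem exists_lintegral_le_energy {α p : ℝ} (hα : 0 < α) (hp : 1 ≤ p) :
    ∃ A : ℝ≥0∞, A ≠ ⊤ ∧ ∀ f : Rn1 n → ℂ, IsNice f → ∫⁻ x, ‖f x‖ₑ ^ p ≤ A * P.energy α p f := by
  obtain ⟨A, hA, hA'⟩ := exists_tsum_min_rpow_le one_lt_two hα hα
  have hA1 : ∑' i : ℕ, ENNReal.ofReal (((2 : ℝ) ^ i) ^ (-α)) ≤ A := by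
    refine le_trans (le_of_eq (tsum_congr fun i => ?_)) (hA' 1 one_pos)
    rw [mul_one, min_eq_right]
    exact Real.rpow_le_rpow_of_exponent_le (one_le_pow₀ one_le_two) (by linarith)
  have hp0 : 0 ≤ p := by linarith
  refine ⟨A ^ (p - 1), ENNReal.rpow_ne_top_of_nonneg (by linarith) hA, fun f hf => ?_⟩
  have hw : ∀ i : ℕ, (ENNReal.ofReal (((2 : ℝ) ^ i) ^ (-α))) ^ (1 - p) ≤
      ENNReal.ofReal (((2 : ℝ) ^ i) ^ (α * p)) := fun i => by
    rw [ENNReal.ofReal_rpow_of_pos (by positivity), ← Real.rpow_mul (by positivity)]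
    exact ENNReal.ofReal_le_ofReal
      (Real.rpow_le_rpow_of_exponent_le (one_le_pow₀ one_le_two) (by nlinarith))
  calc _ ≤ ∫⁻ x, (∑' i, ‖P.piece f i x‖ₑ) ^ p :=
        lintegral_mono fun x => ENNReal.rpow_le_rpow (P.enorm_le_tsum_piece hf x) hp0
    _ ≤ ∫⁻ x, A ^ (p - 1) * ∑' i : ℕ, ENNReal.ofReal (((2 : ℝ) ^ i) ^ (α * p)) *
          ‖P.piece f i x‖ₑ ^ p := by
        refine lintegral_mono fun x => (rpow_tsum_le hp
          (fun i : ℕ => ENNReal.ofReal (((2 : ℝ) ^ i) ^ (-α))) _ (fun i => ?_)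
          (fun i => ENNReal.ofReal_ne_top)).trans ?_
        · simp only [ne_eq, ENNReal.ofReal_eq_zero, not_le]
          positivity
        · exact mul_le_mul' (ENNReal.rpow_le_rpow hA1 (by linarith))
            (ENNReal.tsum_le_tsum fun i => mul_le_mul_left (hw i) _)
    _ = _ := by
        have hm : ∀ i, Measurable fun x => ‖P.piece f i x‖ₑ ^ p := fun i =>
          (P.isNice_piece hf i).cont.enorm.measurable.pow_const p
        rw [lintegral_const_mul' _ _ (ENNReal.rpow_ne_top_of_nonneg (by linarith) hA),
          lintegral_tsum fun i => ((hm i).const_mul _).aemeasurable]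
        simp_rw [lintegral_const_mul' _ _ ENNReal.ofReal_ne_top]
        rfl

theorem exists_timeEnergy_le_energy {α p : ℝ} (hα : 0 < α) (hα2 : α < 2) (hp : 1 ≤ p) :
    ∃ A : ℝ≥0∞, A ≠ ⊤ ∧ ∀ f : Rn1 n → ℂ, IsNice f → timeEnergy α p f ≤ A * P.energy α p f := by
  obtain ⟨C, hC, hC'⟩ := P.exists_difference_bounds hp
  obtain ⟨A, hA, hA'⟩ := exists_lintegral_weight_le_tsum (volume : Measure ℝ)
    (volume : Measure (Rn1 n)) (l := 4) (β := α / 2) (k := 1) (p := p) (by norm_num) (by linarith)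
    (by linarith) hp
  refine ⟨A * C, ENNReal.mul_ne_top hA hC, fun f hf => ?_⟩
  have := hA' (fun t x => ‖f (x + (0, t)) - f x‖ₑ)
    (fun i t x => ‖P.piece f i (x + (0, t)) - P.piece f i x‖ₑ)
    (fun i => ∫⁻ x, ‖P.piece f i x‖ₑ ^ p) C
    (fun i t => by
      have := (P.isNice_piece hf i).cont
      exact (Continuous.enorm (by fun_prop)).measurable)
    (fun t x => P.enorm_difference_le_tsum_piece hf x _)
    (fun i t => by
      have := (hC' (P.ker i) f (2 ^ i) (by positivity) (P.isNice_ker i) hf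
        (fun q hq => P.FT1_ker_of_ge hq i) (0, t)).1
      have e : ‖pdil ((2 : ℝ) ^ i) ((0, t) : Rn1 n)‖ = 4 ^ i * ‖t‖ := by
        simp [pdil, Prod.norm_def, ← pow_mul, mul_comm i 2]
        simp [pow_mul]
        norm_num
      rw [e] at this
      simp only [Real.rpow_one, pow_one] at this ⊢
      exact this)
  simp only [Module.finrank_self, Nat.cast_one, four_pow_rpow] at this
  exact this

theorem exists_spaceEnergy_le_energy (hn : 1 ≤ n) {α p : ℝ} (hα : 0 < α) (hα2 : α < 2)
    (hp : 1 ≤ p) :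
    ∃ A : ℝ≥0∞, A ≠ ⊤ ∧ ∀ f : Rn1 n → ℂ, IsNice f → spaceEnergy α p f ≤ A * P.energy α p f := by
  have : Nonempty (Fin n) := ⟨⟨0, hn⟩⟩
  obtain ⟨C, hC, hC'⟩ := P.exists_difference_bounds hp
  obtain ⟨A, hA, hA'⟩ := exists_lintegral_weight_le_tsum (volume : Measure (Rn n))
    (volume : Measure (Rn1 n)) (l := 2) (β := α) (k := 2) (p := p) (by norm_num) hα hα2 hp
  refine ⟨A * C, ENNReal.mul_ne_top hA hC, fun f hf => ?_⟩
  have := hA' (fun Y x => ‖f (x + (Y, 0)) - 2 * f x + f (x - (Y, 0))‖ₑ)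
    (fun i Y x => ‖P.piece f i (x + (Y, 0)) - 2 * P.piece f i x + P.piece f i (x - (Y, 0))‖ₑ)
    (fun i => ∫⁻ x, ‖P.piece f i x‖ₑ ^ p) C
    (fun i t => by
      have := (P.isNice_piece hf i).cont
      exact (Continuous.enorm (by fun_prop)).measurable)
    (fun Y x => P.enorm_second_difference_le_tsum_piece hf x _)
    (fun i Y => by
      have := (hC' (P.ker i) f (2 ^ i) (by positivity) (P.isNice_ker i) hf
        (fun q hq => P.FT1_ker_of_ge hq i) (Y, 0)).2
      have e : ‖pdil ((2 : ℝ) ^ i) ((Y, 0) : Rn1 n)‖ = 2 ^ i * ‖Y‖ := by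
        simp [pdil, Prod.norm_def, norm_smul]
      rw [e] at this
      rw [Real.rpow_two]
      exact this)
  simp only [finrank_euclideanSpace_fin] at this
  exact this

theorem exists_energy_le (hn : 1 ≤ n) {α p : ℝ} (hα : 0 < α) (hp : 1 ≤ p) :
    ∃ A : ℝ≥0∞, A ≠ ⊤ ∧ ∀ f : Rn1 n → ℂ, IsNice f →
      P.energy α p f ≤ A * ((∫⁻ x, ‖f x‖ₑ ^ p) + timeEnergy α p f + spaceEnergy α p f) := by
  have : Nonempty (Fin n) := ⟨⟨0, hn⟩⟩
  obtain ⟨m, hm⟩ := exists_nat_gt ((n : ℝ) + 1 + p * α)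
  have hpα : 0 < p * α := by positivity
  have hm' : n + 1 < m := by
    have : ((n + 1 : ℕ) : ℝ) < m := by push_cast; linarith
    exact_mod_cast this
  obtain ⟨C, hC, hC'⟩ := P.exists_conv1_pscale_phi_le hp hm'
  obtain ⟨A₁, hA₁, hT⟩ := exists_tsum_lintegral_le_weight (volume : Measure ℝ) (l := 4)
    (β := α / 2) (p := p) (N := (m : ℝ)) (by norm_num) (by linarith) hp
    (by
      have : (0 : ℝ) ≤ n := Nat.cast_nonneg n
      rw [Module.finrank_self]; push_cast; linarith)
  obtain ⟨A₂, hA₂, hX⟩ := exists_tsum_lintegral_le_weight (volume : Measure (Rn n)) (l := 2)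
    (β := α) (p := p) (N := (m : ℝ)) (by norm_num) hα hp
    (by rw [finrank_euclideanSpace_fin]; linarith)
  set L := ∫⁻ y, ‖P.ψ y‖ₑ
  have hL : L ≠ ⊤ := P.ψ.isNice.int.2.ne
  refine ⟨L ^ p + C * (A₁ + A₂), ENNReal.add_ne_top.2
    ⟨ENNReal.rpow_ne_top_of_nonneg (by linarith) hL,
      ENNReal.mul_ne_top hC (ENNReal.add_ne_top.2 ⟨hA₁, hA₂⟩)⟩, fun f hf => ?_⟩
  have hT' := hT _ (measurable_timeDiff p hf.cont)
  have hX' := hX _ (measurable_spaceDiff p hf.cont)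
  simp only [Module.finrank_self, Nat.cast_one, four_pow_rpow, finrank_euclideanSpace_fin]
    at hT' hX'
  set a : ℕ → ℝ≥0∞ := fun i => ENNReal.ofReal (((2 : ℝ) ^ i) ^ (α * p))
  set u : ℕ → ℝ≥0∞ := fun i =>
    ∫⁻ t : ℝ, ENNReal.ofReal ((1 + ‖t‖) ^ (-(m : ℝ))) * timeDiff p f (((4 : ℝ) ^ i)⁻¹ • t)
  set v : ℕ → ℝ≥0∞ := fun i =>
    ∫⁻ Y : Rn n, ENNReal.ofReal ((1 + ‖Y‖) ^ (-(m : ℝ))) * spaceDiff p f (((2 : ℝ) ^ i)⁻¹ • Y)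
  have hsucc : ∀ i, ∫⁻ x, ‖P.piece f (i + 1) x‖ₑ ^ p ≤ C * (u (i + 1) + v (i + 1)) := fun i => by
    refine (hC' f (2 ^ (i + 1)) (by positivity) hf).trans (le_of_eq ?_)
    rw [← pow_mul, mul_comm (i + 1) 2, pow_mul]
    norm_num [u, v]
  have hsum : ∑' i, a (i + 1) * ∫⁻ x, ‖P.piece f (i + 1) x‖ₑ ^ p ≤
      C * (A₁ * timeEnergy α p f + A₂ * spaceEnergy α p f) := by
    calc _ ≤ ∑' i, a (i + 1) * (C * (u (i + 1) + v (i + 1))) :=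
          ENNReal.tsum_le_tsum fun i => mul_le_mul_right (hsucc i) _
      _ ≤ ∑' i, a i * (C * (u i + v i)) :=
          ENNReal.tsum_comp_le_tsum_of_injective (add_left_injective 1)
            (fun i => a i * (C * (u i + v i)))
      _ = C * (∑' i, a i * u i + ∑' i, a i * v i) := by
          rw [← ENNReal.tsum_add, ← ENNReal.tsum_mul_left]
          exact tsum_congr fun i => by ring
      _ ≤ _ := by gcongr; exacts [hT', hX']
  have hzero : a 0 * ∫⁻ x, ‖P.piece f 0 x‖ₑ ^ p ≤ L ^ p * ∫⁻ x, ‖f x‖ₑ ^ p := by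
    simp only [a, pow_zero, Real.one_rpow, ENNReal.ofReal_one, one_mul, piece_zero]
    exact lintegral_enorm_conv1_rpow_le hp P.ψ.continuous hf.cont
  rw [energy, tsum_eq_zero_add' ENNReal.summable]
  refine (add_le_add hzero hsum).trans ?_
  generalize timeEnergy α p f = T
  generalize spaceEnergy α p f = X
  generalize ∫⁻ x, ‖f x‖ₑ ^ p = N
  calc L ^ p * N + C * (A₁ * T + A₂ * X)
      ≤ L ^ p * N + C * (A₁ * T + A₂ * X) + (L ^ p * (T + X) + C * (A₁ * (N + X) + A₂ * (N + T))) :=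
        le_self_add
    _ = _ := by ring

end ParabolicLP
end energy

section seminorms
variable {n : ℕ}

section
variable {E : Type*} [MeasurableSpace E] (μ : Measure E) [SFinite μ] {W : E → ℝ≥0∞}
  {D : E → Rn1 n → ℝ≥0∞}

theorem lintegral_mul_lintegral_Rn1 (hW : Measurable W) (hD : Measurable (Function.uncurry D)) :
    ∫⁻ h, W h * (∫⁻ x, D h x) ∂μ = ∫⁻ x, ∫⁻ h, W h * D h x ∂μ := by
  have hm : Measurable (Function.uncurry fun h x => W h * D h x) :=
    (hW.comp measurable_fst).mul hD
  rw [← lintegral_lintegral_swap hm.aemeasurable]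
  exact lintegral_congr fun h => (lintegral_const_mul _ (hD.comp measurable_prodMk_left)).symm

theorem lintegral_mul_lintegral_Rn1_eq_space_time (hW : Measurable W)
    (hD : Measurable (Function.uncurry D)) :
    ∫⁻ h, W h * (∫⁻ x, D h x) ∂μ = ∫⁻ X : Rn n, ∫⁻ t : ℝ, ∫⁻ h, W h * D h (X, t) ∂μ := by
  have hm : Measurable fun z : Rn1 n × E => W z.2 * D z.2 z.1 :=
    (hW.comp measurable_snd).mul (hD.comp measurable_swap)
  rw [lintegral_mul_lintegral_Rn1 μ hW hD]
  exact lintegral_prod _ hm.lintegral_prod_right'.aemeasurable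

theorem lintegral_mul_lintegral_Rn1_eq_time_space (hW : Measurable W)
    (hD : Measurable (Function.uncurry D)) :
    ∫⁻ h, W h * (∫⁻ x, D h x) ∂μ = ∫⁻ t : ℝ, ∫⁻ X : Rn n, ∫⁻ h, W h * D h (X, t) ∂μ := by
  have hm : Measurable fun z : Rn1 n × E => W z.2 * D z.2 z.1 :=
    (hW.comp measurable_snd).mul (hD.comp measurable_swap)
  rw [lintegral_mul_lintegral_Rn1 μ hW hD]
  exact lintegral_prod_symm _ hm.lintegral_prod_right'.aemeasurable

end

theorem ofReal_norm_rpow_div {p : ℝ} (hp : 0 ≤ p) (z : ℂ) {a : ℝ} (ha : 0 ≤ a) (c : ℝ) :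
    ENNReal.ofReal (‖z‖ ^ p / a ^ c) = ENNReal.ofReal (a ^ (-c)) * ‖z‖ₑ ^ p := by
  rw [div_eq_inv_mul, ← Real.rpow_neg ha, ENNReal.ofReal_mul (by positivity),
    ← ENNReal.ofReal_rpow_of_nonneg (norm_nonneg _) hp, ofReal_norm]

theorem lintegral_time_eq_timeEnergy (α : ℝ) {p : ℝ} (hp : 0 ≤ p) {f : Rn1 n → ℂ}
    (hf : Continuous f) :
    ∫⁻ X : Rn n, ∫⁻ t : ℝ, ∫⁻ s : ℝ,
      ENNReal.ofReal (‖f (X, t) - f (X, s)‖ ^ p / |t - s| ^ (1 + p * α / 2)) =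
      timeEnergy α p f := by
  have hm : Measurable (Function.uncurry fun (h : ℝ) (x : Rn1 n) => ‖f (x + (0, h)) - f x‖ₑ ^ p) :=
    (Continuous.enorm (f := fun z : ℝ × Rn1 n => f (z.2 + (0, z.1)) - f z.2)
      (by fun_prop)).measurable.pow_const p
  rw [timeEnergy]
  simp_rw [timeDiff]
  rw [lintegral_mul_lintegral_Rn1_eq_space_time _ (by fun_prop) hm]
  refine lintegral_congr fun X => lintegral_congr fun t => ?_
  rw [← lintegral_add_left_eq_self _ t]
  refine lintegral_congr fun h => ?_
  rw [norm_sub_rev, ofReal_norm_rpow_div hp _ (abs_nonneg _), sub_add_cancel_left, abs_neg,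
    mul_div_assoc, Real.norm_eq_abs]
  simp

theorem lintegral_space_eq_spaceEnergy (α : ℝ) {p : ℝ} (hp : 0 ≤ p) {f : Rn1 n → ℂ}
    (hf : Continuous f) :
    ∫⁻ t : ℝ, ∫⁻ X : Rn n, ∫⁻ Y : Rn n,
      ENNReal.ofReal (‖f (X + Y, t) - 2 * f (X, t) + f (X - Y, t)‖ ^ p / ‖Y‖ ^ ((n : ℝ) + p * α)) =
      spaceEnergy α p f := by
  have hm : Measurable (Function.uncurry fun (Y : Rn n) (x : Rn1 n) =>
      ‖f (x + (Y, 0)) - 2 * f x + f (x - (Y, 0))‖ₑ ^ p) :=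
    (Continuous.enorm (f := fun z : Rn n × Rn1 n =>
      f (z.2 + (z.1, 0)) - 2 * f z.2 + f (z.2 - (z.1, 0))) (by fun_prop)).measurable.pow_const p
  rw [spaceEnergy]
  simp_rw [spaceDiff]
  rw [lintegral_mul_lintegral_Rn1_eq_time_space _ (by fun_prop) hm]
  refine lintegral_congr fun t => lintegral_congr fun X => lintegral_congr fun Y => ?_
  rw [ofReal_norm_rpow_div hp _ (norm_nonneg _)]
  simp

theorem eLpNorm_ofReal_eq {X F : Type*} [MeasurableSpace X] [NormedAddCommGroup F] (μ : Measure X)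
    {p : ℝ} (hp : 0 < p) (f : X → F) :
    eLpNorm f (ENNReal.ofReal p) μ = (∫⁻ x, ‖f x‖ₑ ^ p ∂μ) ^ (1 / p) := by
  rw [eLpNorm_eq_lintegral_rpow_enorm_toReal (by simpa using hp) ENNReal.ofReal_ne_top,
    ENNReal.toReal_ofReal hp.le]

variable (P : ParabolicLP n)

theorem pBesov_eq {α p : ℝ} (hp : 0 < p) (f : Rn1 n → ℂ) :
    pBesov P α p f = (∫⁻ x, ‖P.piece f 0 x‖ₑ ^ p) ^ (1 / p) +
      (∑' i : ℕ, ENNReal.ofReal (((2 : ℝ) ^ (i + 1)) ^ (α * p)) *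
        ∫⁻ x, ‖P.piece f (i + 1) x‖ₑ ^ p) ^ (1 / p) := by
  rw [pBesov, eLpNorm_ofReal_eq _ hp, P.piece_zero]
  congr 2
  refine tsum_congr fun i => ?_
  rw [eLpNorm_ofReal_eq _ hp, P.piece_succ, ENNReal.mul_rpow_of_nonneg _ _ hp.le,
    ← ENNReal.rpow_mul, one_div_mul_cancel hp.ne', ENNReal.rpow_one,
    ENNReal.ofReal_rpow_of_pos (by positivity), ← Real.rpow_mul zero_le_two,
    ← Real.rpow_natCast 2 (i + 1), ← Real.rpow_mul zero_le_two]
  rw [show α * ((i : ℝ) + 1) * p = ((i + 1 : ℕ) : ℝ) * (α * p) by push_cast; ring]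

theorem ParabolicLP.energy_eq_add (α p : ℝ) (f : Rn1 n → ℂ) :
    P.energy α p f = (∫⁻ x, ‖P.piece f 0 x‖ₑ ^ p) +
      ∑' i : ℕ, ENNReal.ofReal (((2 : ℝ) ^ (i + 1)) ^ (α * p)) *
        ∫⁻ x, ‖P.piece f (i + 1) x‖ₑ ^ p := by
  rw [ParabolicLP.energy, tsum_eq_zero_add' ENNReal.summable]
  simp only [pow_zero, Real.one_rpow, ENNReal.ofReal_one, one_mul]

theorem energy_rpow_le_pBesov {α p : ℝ} (hp : 1 ≤ p) (f : Rn1 n → ℂ) :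
    P.energy α p f ^ (1 / p) ≤ pBesov P α p f := by
  rw [pBesov_eq P (by linarith), P.energy_eq_add]
  exact ENNReal.rpow_add_le_add_rpow _ _ (by positivity) ((div_le_one (by linarith)).2 hp)

theorem pBesov_le_energy_rpow {α p : ℝ} (hp : 1 ≤ p) (f : Rn1 n → ℂ) :
    pBesov P α p f ≤ 2 * P.energy α p f ^ (1 / p) := by
  rw [pBesov_eq P (by linarith), P.energy_eq_add, two_mul]
  gcongr
  · exact le_self_add
  · exact le_add_self

end seminorms

theorem ENNReal.exists_pos_ofReal_mul_le {A : ℝ≥0∞} (hA : A ≠ ⊤) :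
    ∃ c : ℝ, 0 < c ∧ ∀ x y : ℝ≥0∞, x ≤ A * y → ENNReal.ofReal c * x ≤ y := by
  refine ⟨(A.toReal + 1)⁻¹, by positivity, fun x y hxy => ?_⟩
  have h1 : ENNReal.ofReal (A.toReal + 1) = A + 1 := by
    rw [ENNReal.ofReal_add ENNReal.toReal_nonneg zero_le_one, ENNReal.ofReal_toReal hA,
      ENNReal.ofReal_one]
  rw [ENNReal.ofReal_inv_of_pos (by positivity), h1]
  calc (A + 1)⁻¹ * x ≤ (A + 1)⁻¹ * ((A + 1) * y) := by
        gcongr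
        exact hxy.trans (by gcongr; exact le_self_add)
    _ = y := by
        rw [← mul_assoc, ENNReal.inv_mul_cancel (by simp) (ENNReal.add_ne_top.2 ⟨hA, by simp⟩),
          one_mul]

theorem ENNReal.exists_pos_le_ofReal_mul {A : ℝ≥0∞} (hA : A ≠ ⊤) :
    ∃ c : ℝ, 0 < c ∧ ∀ y : ℝ≥0∞, A * y ≤ ENNReal.ofReal c * y := by
  refine ⟨A.toReal + 1, by positivity, fun y => ?_⟩
  rw [ENNReal.ofReal_add ENNReal.toReal_nonneg zero_le_one, ENNReal.ofReal_toReal hA]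
  gcongr
  exact le_self_add

/-- For `0 < α < 2`, the parabolic Besov norm `N_{α,p}` is equivalent to the
norm `‖f‖_p + [f]_{time} + [f]_{space}` of second differences. -/
theorem stmt8 (n : ℕ) (hn : 1 ≤ n) (p : ℝ) (hp : 1 ≤ p) (α : ℝ) (hα0 : 0 < α) (hα2 : α < 2)
    (P : ParabolicLP n) :
    ∃ c C : ℝ, 0 < c ∧ 0 < C ∧
      ∀ f : SchwartzMap (Rn1 n) ℂ,
        ENNReal.ofReal c * pBesov P α p ⇑f ≤
            pNorm p ⇑f
            + (∫⁻ X : Rn n, ∫⁻ t : ℝ, ∫⁻ s : ℝ,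
                ENNReal.ofReal (‖f (X, t) - f (X, s)‖ ^ p / |t - s| ^ (1 + p * α / 2))) ^ (1 / p)
            + (∫⁻ t : ℝ, ∫⁻ X : Rn n, ∫⁻ Y : Rn n,
                ENNReal.ofReal (‖f (X + Y, t) - 2 * f (X, t) + f (X - Y, t)‖ ^ p /
                  ‖Y‖ ^ ((n : ℝ) + p * α))) ^ (1 / p)
          ∧
          pNorm p ⇑f
            + (∫⁻ X : Rn n, ∫⁻ t : ℝ, ∫⁻ s : ℝ,
                ENNReal.ofReal (‖f (X, t) - f (X, s)‖ ^ p / |t - s| ^ (1 + p * α / 2))) ^ (1 / p)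
            + (∫⁻ t : ℝ, ∫⁻ X : Rn n, ∫⁻ Y : Rn n,
                ENNReal.ofReal (‖f (X + Y, t) - 2 * f (X, t) + f (X - Y, t)‖ ^ p /
                  ‖Y‖ ^ ((n : ℝ) + p * α))) ^ (1 / p)
            ≤ ENNReal.ofReal C * pBesov P α p ⇑f := by
  have hp0 : 0 < p := by linarith
  have hq : 0 ≤ 1 / p := by positivity
  have hq1 : 1 / p ≤ 1 := (div_le_one hp0).2 hp
  obtain ⟨A, hA, hA'⟩ := P.exists_energy_le hn hα0 hp
  obtain ⟨B₀, hB₀, hB₀'⟩ := P.exists_lintegral_le_energy hα0 hp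
  obtain ⟨B₁, hB₁, hB₁'⟩ := P.exists_timeEnergy_le_energy hα0 hα2 hp
  obtain ⟨B₂, hB₂, hB₂'⟩ := P.exists_spaceEnergy_le_energy hn hα0 hα2 hp
  have fin : ∀ {D : ℝ≥0∞}, D ≠ ⊤ → D ^ (1 / p) ≠ ⊤ := ENNReal.rpow_ne_top_of_nonneg hq
  obtain ⟨c, hc, hc'⟩ := ENNReal.exists_pos_ofReal_mul_le
    (ENNReal.mul_ne_top ENNReal.ofNat_ne_top (fin hA) : 2 * A ^ (1 / p) ≠ ⊤)
  obtain ⟨C, hC, hC'⟩ := ENNReal.exists_pos_le_ofReal_mul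
    (ENNReal.add_ne_top.2 ⟨ENNReal.add_ne_top.2 ⟨fin hB₀, fin hB₁⟩, fin hB₂⟩)
  refine ⟨c, C, hc, hC, fun f => ?_⟩
  rw [lintegral_time_eq_timeEnergy α hp0.le f.continuous,
    lintegral_space_eq_spaceEnergy α hp0.le f.continuous, pNorm, eLpNorm_ofReal_eq _ hp0]
  have hf := f.isNice
  constructor
  · refine hc' _ _ ((pBesov_le_energy_rpow P hp f).trans ?_)
    rw [mul_assoc]
    gcongr
    refine (ENNReal.rpow_le_rpow (hA' f hf) hq).trans ?_
    rw [ENNReal.mul_rpow_of_nonneg _ _ hq]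
    gcongr
    refine (ENNReal.rpow_add_le_add_rpow _ _ hq hq1).trans ?_
    gcongr
    exact ENNReal.rpow_add_le_add_rpow _ _ hq hq1
  · refine le_trans ?_ (hC' _)
    have key : ∀ {x D : ℝ≥0∞}, x ≤ D * P.energy α p f →
        x ^ (1 / p) ≤ D ^ (1 / p) * pBesov P α p f := fun {x D} hx => by
      refine (ENNReal.rpow_le_rpow hx hq).trans ?_
      rw [ENNReal.mul_rpow_of_nonneg _ _ hq]
      gcongr
      exact energy_rpow_le_pBesov P hp f
    rw [add_mul, add_mul]
    exact add_le_add (add_le_add (key (hB₀' f hf)) (key (hB₁' f hf))) (key (hB₂' f hf))
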